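/- arXiv:0805.1918 — 2 statements merged into one kernel-verified Lean document; each statement's English description precedes it below -/
import Mathlib

section
/- Let H_l ∈ Λ_{2n} be a fermionic spherical harmonic of degree l (so 0 ≤ l ≤ n). Then F^±_{0|2n}(H_l(x) · exp(x`²/2))(y) = (±i)^l · H_l(y) · exp(y`²/2), where H_l(y) denotes the same element written in the y` variables. -/
open scoped BigOperators
open Finset MeasureTheory

noncomputable section

/-- The Grassmann algebra on `N` anticommuting generators with coefficients in a
commutative ring `R`, represented by its coefficients with respect to the basis of
increasingly-ordered monomials, indexed by subsets of the generators. -/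
abbrev Gr (R : Type) (N : ℕ) : Type := Finset (Fin N) → R

namespace Gr

variable {R : Type} [CommRing R] {N : ℕ}

/-- The sign produced when reordering the concatenation of the ordered monomials indexed
by `A` and `B` into the ordered monomial indexed by `A ∪ B`. -/
def msign (A B : Finset (Fin N)) : R :=
  (-1 : R) ^ (((A ×ˢ B).filter fun p => p.2 < p.1).card)

/-- Multiplication of the Grassmann algebra. -/
def mul (f g : Gr R N) : Gr R N :=
  fun s => ∑ A ∈ s.powerset, msign A (s \ A) * f A * g (s \ A)

/-- The unit of the Grassmann algebra. -/
def one : Gr R N := fun s => if s = (∅ : Finset (Fin N)) then 1 else 0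

/-- The `j`-th generator of the Grassmann algebra. -/
def gen (j : Fin N) : Gr R N := fun s => if s = {j} then 1 else 0

/-- Powers in the Grassmann algebra. -/
def pow (f : Gr R N) : ℕ → Gr R N
  | 0 => one
  | k + 1 => mul (pow f k) f

/-- The left partial derivative `∂_j`, i.e. the odd derivation with `∂_j(x_k) = δ_{jk}`. -/
def pderiv (j : Fin N) (f : Gr R N) : Gr R N :=
  fun s => if j ∈ s then 0
    else (-1 : R) ^ ((s.filter fun i => i < j).card) * f (insert j s)

/-- The exponential of a Grassmann algebra element with nilpotent (zero-constant-term)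
argument: the series terminates, and all terms beyond degree `N` vanish. -/
def gexp (f : Gr ℂ N) : Gr ℂ N :=
  ∑ k ∈ Finset.range (N + 1), ((k.factorial : ℂ))⁻¹ • pow f k

/-- Iterated left partial derivatives: the first element of the list acts first. -/
def derivList (l : List (Fin N)) (f : Gr R N) : Gr R N :=
  l.foldl (fun g j => pderiv j g) f

/-- Complex conjugation of the coefficients. -/
def gconj (f : Gr ℂ N) : Gr ℂ N := fun s => (starRingEnd ℂ) (f s)

end Gr

/-- The Lean index of the paper's generator `x`_{2j-1}` (j = 1,…,n). -/
def lo (n : ℕ) (j : Fin n) : Fin (2 * n) := ⟨2 * (j : ℕ), by have := j.isLt; omega⟩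

/-- The Lean index of the paper's generator `x`_{2j}` (j = 1,…,n). -/
def hi (n : ℕ) (j : Fin n) : Fin (2 * n) := ⟨2 * (j : ℕ) + 1, by have := j.isLt; omega⟩

/-- `x`² = Σ_{j=1}^n x`_{2j-1} x`_{2j}`. -/
def xsq (n : ℕ) : Gr ℂ (2 * n) := ∑ j : Fin n, Gr.mul (Gr.gen (lo n j)) (Gr.gen (hi n j))

/-- The fermionic Laplace operator `Δ_f = 4 Σ_{j=1}^n ∂_{x`_{2j-1}} ∂_{x`_{2j}}`. -/
def lapF (n : ℕ) (f : Gr ℂ (2 * n)) : Gr ℂ (2 * n) :=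
  (4 : ℂ) • ∑ j : Fin n, Gr.pderiv (lo n j) (Gr.pderiv (hi n j) f)

/-- The Berezin integral `∫_B = π^{-n} ∂_{x`_{2n}} ⋯ ∂_{x`_1}`. -/
def berezin (n : ℕ) (f : Gr ℂ (2 * n)) : ℂ :=
  ((Real.pi : ℂ) ^ n)⁻¹ * Gr.derivList (List.finRange (2 * n)) f ∅

/-- The fermionic Gaussian `exp(x`²/2) = Σ_{j=0}^n (x`²)^j/(2^j j!)`. -/
def fermGauss (n : ℕ) : Gr ℂ (2 * n) :=
  ∑ j ∈ Finset.range (n + 1), (((2 : ℂ) ^ j * j.factorial)⁻¹) • Gr.pow (xsq n) j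

/-- Embedding of the `x` generators into the Grassmann algebra on the `4n` generators
`x`_1, …, x`_{2n}, y`_1, …, y`_{2n}` (the `x` generators come first). -/
def xi (n : ℕ) (t : Fin (2 * n)) : Fin (2 * n + 2 * n) := Fin.castAdd (2 * n) t

/-- Embedding of the `y` generators into the Grassmann algebra on the `4n` generators. -/
def yi (n : ℕ) (t : Fin (2 * n)) : Fin (2 * n + 2 * n) := Fin.natAdd (2 * n) t

/-- The algebra embedding `Λ_{2n} → Λ_{4n}` sending the generators to the `x` generators. -/
def embX (n : ℕ) (f : Gr ℂ (2 * n)) : Gr ℂ (2 * n + 2 * n) :=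
  fun s => ∑ A : Finset (Fin (2 * n)), if s = A.image (xi n) then f A else 0

/-- The Berezin integral with respect to the `x` variables,
`π^{-n} ∂_{x`_{2n}} ⋯ ∂_{x`_1}`, inside the mixed algebra `Λ_{4n}`. -/
def berezinX (n : ℕ) (F : Gr ℂ (2 * n + 2 * n)) : Gr ℂ (2 * n + 2 * n) :=
  ((Real.pi : ℂ) ^ n)⁻¹ • Gr.derivList ((List.finRange (2 * n)).map (xi n)) F

/-- The fermionic Fourier kernel
`K^σ(x, y) = exp(-σ (i/2) Σ_{j=1}^n (x`_{2j-1} y`_{2j} - x`_{2j} y`_{2j-1}))`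
(for the plus sign `σ = 1`, for the minus sign `σ = -1`). -/
def fermK (n : ℕ) (σ : ℂ) : Gr ℂ (2 * n + 2 * n) :=
  Gr.gexp ((-σ * (Complex.I / 2)) • ∑ j : Fin n,
    (Gr.mul (Gr.gen (xi n (lo n j))) (Gr.gen (yi n (hi n j))) -
     Gr.mul (Gr.gen (xi n (hi n j))) (Gr.gen (yi n (lo n j)))))

/-- The fermionic Fourier transform
`F^σ_{0|2n}(g)(y) = (2π)^n ∫_{B,x} K^σ(x,y) g(x)`, an element of the Grassmann algebra
in the `y` variables, identified with `Λ_{2n}`. -/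
def fermFT (n : ℕ) (σ : ℂ) (g : Gr ℂ (2 * n)) : Gr ℂ (2 * n) :=
  fun s => (((2 * Real.pi : ℝ) : ℂ) ^ n) *
    berezinX n (Gr.mul (fermK n σ) (embX n g)) (s.image (yi n))


end

namespace Gr

variable {N : ℕ}

theorem msign_eq_prod (A B : Finset (Fin N)) :
    (msign A B : ℂ) = ∏ p ∈ A, ∏ q ∈ B, if q < p then -1 else 1 := by
  rw [← Finset.prod_product' (f := fun p q => if q < p then (-1 : ℂ) else 1), Finset.prod_ite]
  simp [msign]

theorem mul_sum {ι : Type*} (f : Gr ℂ N) (T : Finset ι) (g : ι → Gr ℂ N) :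
    mul f (∑ i ∈ T, g i) = ∑ i ∈ T, mul f (g i) := by
  ext s
  simp only [mul, Finset.sum_apply, Finset.mul_sum]
  exact Finset.sum_comm

theorem mul_smul (f g : Gr ℂ N) (c : ℂ) : mul f (c • g) = c • mul f g := by
  ext s
  simp only [mul, Pi.smul_apply, smul_eq_mul, Finset.mul_sum]
  exact Finset.sum_congr rfl fun _ _ => by ring

theorem smul_mul (f g : Gr ℂ N) (c : ℂ) : mul (c • f) g = c • mul f g := by
  ext s
  simp only [mul, Pi.smul_apply, smul_eq_mul, Finset.mul_sum]
  exact Finset.sum_congr rfl fun _ _ => by ring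

theorem smul_pow (f : Gr ℂ N) (c : ℂ) (k : ℕ) : pow (c • f) k = c ^ k • pow f k := by
  induction k with
  | zero => simp [pow]
  | succ k ih => rw [pow, ih, smul_mul, mul_smul, smul_smul, pow, pow_succ]

/-- Reindexing the product by the right factor. -/
theorem mul_apply_eq_sum_right (f g : Gr ℂ N) (s : Finset (Fin N)) :
    mul f g s = ∑ B ∈ s.powerset, msign (s \ B) B * f (s \ B) * g B := by
  refine Finset.sum_bij' (fun A _ => s \ A) (fun A _ => s \ A) ?_ ?_ ?_ ?_ ?_ <;>
    simp +contextual

theorem gen_mul_gen {a b : Fin N} (h : a < b) :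
    mul (gen a) (gen b) = fun s => if s = {a, b} then (1 : ℂ) else 0 := by
  have key : ∀ s : Finset (Fin N), s = {a, b} ↔ a ∈ s ∧ s \ {a} = {b} := by
    intro s
    constructor
    · rintro rfl
      refine ⟨by simp, ?_⟩
      ext x
      simp only [Finset.mem_sdiff, Finset.mem_insert, Finset.mem_singleton]
      constructor
      · tauto
      · rintro rfl
        exact ⟨Or.inr rfl, h.ne'⟩
    · rintro ⟨ha, hs⟩
      rw [← hs]
      ext x
      by_cases hx : x = a <;> simp [hx, ha]
  ext s
  simp only [mul, gen, mul_ite, mul_one, mul_zero]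
  rw [if_congr (key s) rfl rfl]
  by_cases ha : a ∈ s
  · rw [Finset.sum_eq_single {a}]
    · by_cases hs : s \ {a} = {b}
      · simp [hs, ha, msign_eq_prod, not_lt.2 h.le]
      · simp [hs]
    · intro A _ hA
      simp [hA]
    · simp [ha]
  · rw [if_neg (by tauto)]
    refine Finset.sum_eq_zero fun A hA => ?_
    have : A ≠ {a} := by
      rintro rfl
      simp at hA
      exact ha hA
    simp [this]

theorem mul_gen_mul_gen_apply (f : Gr ℂ N) {a b : Fin N} (h : a < b) (s : Finset (Fin N)) :
    mul f (mul (gen a) (gen b)) s =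
      if a ∈ s ∧ b ∈ s then msign (s \ {a, b}) {a, b} * f (s \ {a, b}) else 0 := by
  rw [gen_mul_gen h, mul_apply_eq_sum_right]
  simp only [mul_ite, mul_one, mul_zero, Finset.sum_ite_eq', Finset.mem_powerset,
    Finset.insert_subset_iff, Finset.singleton_subset_iff]

theorem derivList_apply_of_sorted (l : List (Fin N)) (F : Gr ℂ N) (s : Finset (Fin N))
    (hl : l.Pairwise (· < ·)) (hs : ∀ a ∈ l, ∀ b ∈ s, a < b) :
    derivList l F s = F (l.toFinset ∪ s) := by
  induction l generalizing F with
  | nil => simp [derivList]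
  | cons a l ih =>
    rw [List.pairwise_cons] at hl
    have hlt : ∀ b ∈ l.toFinset ∪ s, a < b := by
      intro b hb
      rcases Finset.mem_union.1 hb with hb | hb
      · exact hl.1 b (List.mem_toFinset.1 hb)
      · exact hs a (by simp) b hb
    have h1 : derivList (a :: l) F s = derivList l (pderiv a F) s := rfl
    rw [h1, ih _ hl.2 fun c hc => hs c (by simp [hc]), pderiv,
      if_neg fun ha => lt_irrefl _ (hlt a ha),
      Finset.filter_false_of_mem fun b hb => (hlt b hb).le.not_gt]
    simp [Finset.insert_union]

end Gr

section Pairs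

variable {n : ℕ}

/-- The index of the pair `{x_{2j-1}, x_{2j}}` containing a generator. -/
def pairIdx (t : Fin (2 * n)) : Fin n := ⟨(t : ℕ) / 2, by have := t.isLt; omega⟩

/-- The involution exchanging the two generators of each pair. -/
def partner (t : Fin (2 * n)) : Fin (2 * n) :=
  ⟨if (t : ℕ) % 2 = 0 then t + 1 else t - 1, by have := t.isLt; split <;> omega⟩

theorem partner_involutive : Function.Involutive (partner (n := n)) := by
  intro t
  apply Fin.ext
  simp only [partner]
  split_ifs <;> omega

/-- `partner` as a permutation. -/
def partnerPerm (n : ℕ) : Equiv.Perm (Fin (2 * n)) := partner_involutive.toPerm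

@[simp] theorem partnerPerm_apply (t : Fin (2 * n)) : partnerPerm n t = partner t := rfl

@[simp] theorem partnerPerm_symm : (partnerPerm n).symm = partnerPerm n := rfl

@[simp] theorem partner_partner (t : Fin (2 * n)) : partner (partner t) = t :=
  partner_involutive t

@[simp] theorem pairIdx_lo (j : Fin n) : pairIdx (lo n j) = j := by
  apply Fin.ext; simp only [pairIdx, lo]; omega

@[simp] theorem pairIdx_hi (j : Fin n) : pairIdx (hi n j) = j := by
  apply Fin.ext; simp only [pairIdx, hi]; omega

@[simp] theorem partner_lo (j : Fin n) : partner (lo n j) = hi n j := by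
  simp [partner, lo, hi]

@[simp] theorem partner_hi (j : Fin n) : partner (hi n j) = lo n j := by
  simp [partner, lo, hi, Nat.add_mod]

theorem eq_lo_or_eq_hi (t : Fin (2 * n)) : t = lo n (pairIdx t) ∨ t = hi n (pairIdx t) := by
  rcases Nat.mod_two_eq_zero_or_one t with h | h
  · left; apply Fin.ext; simp only [pairIdx, lo]; omega
  · right; apply Fin.ext; simp only [pairIdx, hi]; omega

theorem lo_lt_hi (j : Fin n) : lo n j < hi n j := by
  simp [lo, hi, Fin.lt_def]

theorem sum_eq_sum_lo_add_hi {M : Type*} [AddCommMonoid M] (f : Fin (2 * n) → M) :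
    ∑ t, f t = ∑ j : Fin n, (f (lo n j) + f (hi n j)) := by
  rw [← Finset.sum_fiberwise_of_maps_to (g := pairIdx) (t := Finset.univ) (by simp)]
  refine Finset.sum_congr rfl fun j _ => ?_
  rw [← Finset.sum_pair (lo_lt_hi j).ne]
  congr 1
  ext t
  simp only [Finset.mem_filter, Finset.mem_univ, true_and, Finset.mem_insert,
    Finset.mem_singleton]
  constructor
  · rintro rfl
    exact eq_lo_or_eq_hi t
  · rintro (rfl | rfl) <;> simp

/-- The union of the pairs indexed by `Q`. -/
def pairs (Q : Finset (Fin n)) : Finset (Fin (2 * n)) := {t | pairIdx t ∈ Q}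

/-- The pairs contained in `s`. -/
def fullPairs (s : Finset (Fin (2 * n))) : Finset (Fin n) := {j | lo n j ∈ s ∧ hi n j ∈ s}

@[simp] theorem mem_pairs {Q : Finset (Fin n)} {t : Fin (2 * n)} :
    t ∈ pairs Q ↔ pairIdx t ∈ Q := by simp [pairs]

@[simp] theorem mem_fullPairs {s : Finset (Fin (2 * n))} {j : Fin n} :
    j ∈ fullPairs s ↔ lo n j ∈ s ∧ hi n j ∈ s := by simp [fullPairs]

theorem pairIdx_mem_fullPairs {s : Finset (Fin (2 * n))} {t : Fin (2 * n)} :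
    pairIdx t ∈ fullPairs s ↔ t ∈ s ∧ partner t ∈ s := by
  rw [mem_fullPairs]
  rcases eq_lo_or_eq_hi t with h | h <;> rw [h] <;> simp [and_comm]

theorem card_pairs (Q : Finset (Fin n)) : (pairs Q).card = 2 * Q.card := by
  have h : (pairs Q).card = ∑ t : Fin (2 * n), if pairIdx t ∈ Q then 1 else 0 := by
    rw [pairs, Finset.card_filter]
  rw [h, sum_eq_sum_lo_add_hi]
  simp only [pairIdx_lo, pairIdx_hi, Finset.sum_add_distrib, Finset.sum_boole]
  simp [two_mul]

theorem pairs_injective : Function.Injective (pairs (n := n)) := by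
  intro P Q h
  ext j
  have := congrArg (lo n j ∈ ·) h
  simpa using this

theorem pairs_subset_iff {Q : Finset (Fin n)} {s : Finset (Fin (2 * n))} :
    pairs Q ⊆ s ↔ Q ⊆ fullPairs s := by
  constructor
  · intro h j hj
    exact mem_fullPairs.2 ⟨h (by simpa), h (by simpa)⟩
  · intro h t ht
    have := mem_fullPairs.1 (h (mem_pairs.1 ht))
    rcases eq_lo_or_eq_hi t with e | e <;> rw [e]
    exacts [this.1, this.2]

theorem prod_pairs {M : Type*} [CommMonoid M] (Q : Finset (Fin n)) (f : Fin (2 * n) → M) :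
    ∏ t ∈ pairs Q, f t = ∏ j ∈ Q, f (lo n j) * f (hi n j) := by
  have := sum_eq_sum_lo_add_hi (M := Additive M)
    (fun t => Additive.ofMul (if pairIdx t ∈ Q then f t else 1))
  have h2 : ∏ t, (if pairIdx t ∈ Q then f t else 1) = ∏ j : Fin n,
    ((if pairIdx (lo n j) ∈ Q then f (lo n j) else 1) *
      (if pairIdx (hi n j) ∈ Q then f (hi n j) else 1)) := this
  rw [pairs, Finset.prod_filter, h2]
  simp only [pairIdx_lo, pairIdx_hi]
  rw [← Finset.prod_subset (Finset.subset_univ Q)]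
  · exact Finset.prod_congr rfl fun j hj => by simp [hj]
  · intro j _ hj
    simp [hj]

theorem msign_pairs (A : Finset (Fin (2 * n))) (Q : Finset (Fin n))
    (h : Disjoint A (pairs Q)) : (Gr.msign A (pairs Q) : ℂ) = 1 := by
  rw [Gr.msign_eq_prod]
  refine Finset.prod_eq_one fun p hp => ?_
  rw [prod_pairs]
  refine Finset.prod_eq_one fun j hj => ?_
  have hpj : pairIdx p ≠ j := fun e =>
    Finset.disjoint_left.1 h hp (mem_pairs.2 (by rwa [e]))
  have : lo n j < p ↔ hi n j < p := by
    simp only [pairIdx, ne_eq, Fin.ext_iff, lo, hi, Fin.lt_def] at *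
    omega
  by_cases hl : hi n j < p <;> simp [this, hl]

theorem pairs_singleton (j : Fin n) : pairs {j} = {lo n j, hi n j} := by
  ext t
  simp only [mem_pairs, Finset.mem_singleton, Finset.mem_insert]
  constructor
  · rintro rfl
    exact eq_lo_or_eq_hi t
  · rintro (rfl | rfl) <;> simp

theorem pairs_sdiff (P Q : Finset (Fin n)) : pairs (P \ Q) = pairs P \ pairs Q := by
  ext t; simp

theorem fullPairs_sdiff_pairs (s : Finset (Fin (2 * n))) (Q : Finset (Fin n)) :
    fullPairs (s \ pairs Q) = fullPairs s \ Q := by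
  ext j
  simp only [mem_fullPairs, Finset.mem_sdiff, mem_pairs, pairIdx_lo, pairIdx_hi]
  tauto

theorem pow_xsq_apply (k : ℕ) (s : Finset (Fin (2 * n))) :
    Gr.pow (xsq n) k s =
      if s = pairs (fullPairs s) ∧ (fullPairs s).card = k then (k.factorial : ℂ) else 0 := by
  induction k generalizing s with
  | zero =>
    simp only [Gr.pow, Gr.one, Nat.factorial_zero, Nat.cast_one]
    refine if_congr ⟨?_, ?_⟩ rfl rfl
    · rintro rfl
      simp [fullPairs, pairs]
    · rintro ⟨h, hc⟩
      rw [h, Finset.card_eq_zero.1 hc]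
      simp [pairs]
  | succ k ih =>
    rw [Gr.pow, xsq, Gr.mul_sum, Finset.sum_apply, ← xsq]
    have hterm : ∀ j : Fin n,
        Gr.mul (Gr.pow (xsq n) k) (Gr.mul (Gr.gen (lo n j)) (Gr.gen (hi n j))) s =
          if j ∈ fullPairs s then
            (if s = pairs (fullPairs s) ∧ (fullPairs s).card = k + 1 then (k.factorial : ℂ) else 0)
          else 0 := by
      intro j
      rw [Gr.mul_gen_mul_gen_apply _ (lo_lt_hi j), ← pairs_singleton,
        msign_pairs _ _ Finset.sdiff_disjoint, ih, fullPairs_sdiff_pairs, one_mul]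
      refine ite_congr (by simp) (fun hj => ?_) fun _ => rfl
      have hj' : pairs {j} ⊆ s := pairs_subset_iff.2 (by simpa using hj)
      rw [pairs_sdiff]
      refine if_congr (and_congr ⟨fun h => ?_, fun h => by rw [← h]⟩ ?_) rfl rfl
      · have hj'' : pairs {j} ⊆ pairs (fullPairs s) := by
          intro t ht
          rw [mem_pairs, Finset.mem_singleton] at ht
          rwa [mem_pairs, ht]
        rw [← Finset.sdiff_union_of_subset hj'', ← h, Finset.sdiff_union_of_subset hj']
      · have := Finset.card_pos.2 ⟨j, hj⟩
        rw [Finset.sdiff_singleton_eq_erase, Finset.card_erase_of_mem hj]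
        omega
    rw [Finset.sum_congr rfl fun j _ => hterm j, Finset.sum_ite_mem, Finset.univ_inter,
      Finset.sum_const, nsmul_eq_mul]
    split_ifs with h
    · rw [h.2, Nat.factorial_succ]
      push_cast
      ring
    · simp

theorem fermGauss_apply (s : Finset (Fin (2 * n))) :
    fermGauss n s = if s = pairs (fullPairs s) then ((2 : ℂ) ^ (fullPairs s).card)⁻¹ else 0 := by
  simp only [fermGauss, Finset.sum_apply, Pi.smul_apply, pow_xsq_apply, smul_eq_mul]
  split_ifs with h
  · rw [Finset.sum_eq_single (fullPairs s).card]
    · have : ((fullPairs s).card.factorial : ℂ) ≠ 0 := by exact_mod_cast Nat.factorial_ne_zero _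
      rw [if_pos ⟨h, rfl⟩]
      field_simp
    · intro k _ hk
      rw [if_neg fun h' => hk h'.2.symm, mul_zero]
    · intro hk
      have := (fullPairs s).card_le_univ
      simp only [Fintype.card_fin] at this
      simp only [Finset.mem_range] at hk
      omega
  · simp [h]

theorem fullPairs_pairs (Q : Finset (Fin n)) : fullPairs (pairs Q) = Q := by
  ext j; simp

theorem sdiff_pairs_eq (s : Finset (Fin (2 * n))) {Q : Finset (Fin n)} (hQ : Q ⊆ fullPairs s) :
    s \ pairs Q = s \ pairs (fullPairs s) ∪ pairs (fullPairs s \ Q) := by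
  ext t
  have := @hQ (pairIdx t)
  simp only [Finset.mem_sdiff, Finset.mem_union, mem_pairs, pairIdx_mem_fullPairs] at this ⊢
  tauto

theorem mul_fermGauss_apply (H : Gr ℂ (2 * n)) (s : Finset (Fin (2 * n))) :
    Gr.mul H (fermGauss n) s =
      ∑ Q ∈ (fullPairs s).powerset, ((2 : ℂ) ^ (fullPairs s \ Q).card)⁻¹ *
        H (s \ pairs (fullPairs s) ∪ pairs Q) := by
  have hsum : ∑ Q ∈ (fullPairs s).powerset, ((2 : ℂ) ^ (fullPairs s \ Q).card)⁻¹ *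
        H (s \ pairs (fullPairs s) ∪ pairs Q) =
      ∑ Q ∈ (fullPairs s).powerset, ((2 : ℂ) ^ Q.card)⁻¹ * H (s \ pairs Q) := by
    refine Finset.sum_bij' (fun Q _ => fullPairs s \ Q) (fun Q _ => fullPairs s \ Q)
      ?_ ?_ ?_ ?_ ?_
    · simp
    · simp
    · simp +contextual
    · simp +contextual
    · intro Q hQ
      rw [Finset.mem_powerset] at hQ
      rw [sdiff_pairs_eq s Finset.sdiff_subset, Finset.sdiff_sdiff_eq_self hQ]
  rw [hsum, Gr.mul_apply_eq_sum_right]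
  symm
  refine Finset.sum_of_injOn pairs pairs_injective.injOn ?_ ?_ ?_
  · intro Q hQ
    simpa [pairs_subset_iff] using hQ
  · intro B hB hB'
    rw [fermGauss_apply, if_neg, mul_zero]
    intro h
    refine hB' ⟨fullPairs B, ?_, h.symm⟩
    rw [Finset.mem_coe, Finset.mem_powerset, ← pairs_subset_iff, ← h]
    exact Finset.mem_powerset.1 hB
  · intro Q _
    rw [msign_pairs _ _ Finset.sdiff_disjoint, fermGauss_apply, fullPairs_pairs, if_pos rfl]
    ring

/-- The image of `s` under exchanging the two generators of each pair. Followed by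
complementation, this exchanges the full and the empty pairs. -/
def swapPairs (s : Finset (Fin (2 * n))) : Finset (Fin (2 * n)) :=
  s.map (partnerPerm n).toEmbedding

@[simp] theorem mem_swapPairs {s : Finset (Fin (2 * n))} {t : Fin (2 * n)} :
    t ∈ swapPairs s ↔ partner t ∈ s := by
  simp [swapPairs, Finset.mem_map_equiv]

@[simp] theorem card_swapPairs (s : Finset (Fin (2 * n))) : (swapPairs s).card = s.card :=
  Finset.card_map _

@[simp] theorem swapPairs_swapPairs (s : Finset (Fin (2 * n))) : swapPairs (swapPairs s) = s := by
  ext t; simp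

theorem prod_swapPairs {M : Type*} [CommMonoid M] (s : Finset (Fin (2 * n)))
    (f : Fin (2 * n) → M) : ∏ t ∈ swapPairs s, f t = ∏ t ∈ s, f (partner t) :=
  Finset.prod_map _ _ _

theorem swapPairs_erase (s : Finset (Fin (2 * n))) (t : Fin (2 * n)) :
    swapPairs (s.erase t) = (swapPairs s).erase (partner t) := by
  ext u
  simp [partner_involutive.eq_iff]

theorem fullPairs_swapPairs (s : Finset (Fin (2 * n))) : fullPairs (swapPairs s) = fullPairs s := by
  ext j; simp [and_comm]

end Pairs

section Kernel

variable {n : ℕ}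

theorem xi_injective : Function.Injective (xi n) := Fin.castAdd_injective _ _

theorem yi_injective : Function.Injective (yi n) := Fin.natAdd_injective _ _

@[simp] theorem xi_lt_xi {a b : Fin (2 * n)} : xi n a < xi n b ↔ a < b := Iff.rfl

@[simp] theorem yi_lt_yi {a b : Fin (2 * n)} : yi n a < yi n b ↔ a < b := by
  simp [yi]

@[simp] theorem xi_lt_yi (a b : Fin (2 * n)) : xi n a < yi n b := by
  simp only [xi, yi, Fin.lt_def, Fin.val_castAdd, Fin.val_natAdd]
  omega

@[simp] theorem not_yi_lt_xi (a b : Fin (2 * n)) : ¬ yi n b < xi n a :=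
  (xi_lt_yi a b).not_gt

/-- The index set of the monomial `x_A y_B` in the mixed algebra. -/
def xy (A B : Finset (Fin (2 * n))) : Finset (Fin (2 * n + 2 * n)) :=
  A.image (xi n) ∪ B.image (yi n)

@[simp] theorem xi_mem_xy {A B : Finset (Fin (2 * n))} {t : Fin (2 * n)} :
    xi n t ∈ xy A B ↔ t ∈ A := by
  simp only [xy, Finset.mem_union, Finset.mem_image, xi_injective.eq_iff, exists_eq_right,
    (xi_lt_yi _ _).ne', and_false, exists_false, or_false]

@[simp] theorem yi_mem_xy {A B : Finset (Fin (2 * n))} {t : Fin (2 * n)} :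
    yi n t ∈ xy A B ↔ t ∈ B := by
  simp only [xy, Finset.mem_union, Finset.mem_image, yi_injective.eq_iff, exists_eq_right,
    (xi_lt_yi _ _).ne, and_false, exists_false, false_or]

theorem ext_xi_yi {s t : Finset (Fin (2 * n + 2 * n))} (hx : ∀ a, xi n a ∈ s ↔ xi n a ∈ t)
    (hy : ∀ a, yi n a ∈ s ↔ yi n a ∈ t) : s = t := by
  ext u
  induction u using Fin.addCases with
  | left a => exact hx a
  | right a => exact hy a

theorem prod_xy {M : Type*} [CommMonoid M] (A B : Finset (Fin (2 * n)))
    (f : Fin (2 * n + 2 * n) → M) :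
    ∏ u ∈ xy A B, f u = (∏ a ∈ A, f (xi n a)) * ∏ b ∈ B, f (yi n b) := by
  rw [xy, Finset.prod_union, Finset.prod_image xi_injective.injOn,
    Finset.prod_image yi_injective.injOn]
  rw [Finset.disjoint_left]
  intro u hu hu'
  obtain ⟨a, _, rfl⟩ := Finset.mem_image.1 hu
  obtain ⟨b, _, h⟩ := Finset.mem_image.1 hu'
  exact (xi_lt_yi a b).ne' h

/-- The coefficient sign of `x_A y_{swapPairs A}` in the exponential kernel. -/
def kerSign (A : Finset (Fin (2 * n))) : ℂ := (-1) ^ (fullPairs A).card * Gr.msign A Aᶜ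

theorem prod_lt_mul_prod_lt (A : Finset (Fin (2 * n))) (t : Fin (2 * n)) :
    (∏ q ∈ Aᶜ, if q < t then (-1 : ℂ) else 1) * ∏ p ∈ A.erase t, (if t < p then (-1 : ℂ) else 1) =
      (-1) ^ (t : ℕ) * (-1) ^ (A.erase t).card := by
  have h1 : ∏ p ∈ A.erase t, (if t < p then (-1 : ℂ) else 1) =
      (∏ p ∈ A.erase t, (if p < t then (-1 : ℂ) else 1)) * (-1) ^ (A.erase t).card := by
    rw [← Finset.prod_const, ← Finset.prod_mul_distrib]
    refine Finset.prod_congr rfl fun p hp => ?_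
    rcases lt_or_gt_of_ne (Finset.ne_of_mem_erase hp) with h | h <;> simp [h, h.not_gt]
  have h2 : ∏ p ∈ A.erase t, (if p < t then (-1 : ℂ) else 1) =
      ∏ p ∈ A, (if p < t then (-1 : ℂ) else 1) := Finset.prod_erase _ (by simp)
  rw [h1, h2, ← mul_assoc, Finset.prod_compl_mul_prod, Finset.prod_ite, Finset.prod_const,
    Finset.prod_const_one, mul_one, Finset.filter_gt_eq_Iio, Fin.card_Iio]

theorem neg_one_pow_card_fullPairs_erase {A : Finset (Fin (2 * n))} {t : Fin (2 * n)}
    (ht : t ∈ A) :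
    (∏ u ∈ A.erase t, if u = partner t then (-1 : ℂ) else 1) *
      (-1) ^ (fullPairs (A.erase t)).card = (-1) ^ (fullPairs A).card := by
  have hne : partner t ≠ t := by
    simp only [partner, ne_eq, Fin.ext_iff]
    split_ifs <;> omega
  have hfull : fullPairs (A.erase t) = (fullPairs A).erase (pairIdx t) := by
    ext j
    have h : pairIdx t = j ↔ t = lo n j ∨ t = hi n j := by
      rw [← Finset.mem_singleton, ← mem_pairs, pairs_singleton, Finset.mem_insert,
        Finset.mem_singleton]
    simp only [mem_fullPairs, Finset.mem_erase, ne_eq, eq_comm (b := t), eq_comm (b := pairIdx t),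
      h]
    tauto
  have hmem : pairIdx t ∈ fullPairs A ↔ partner t ∈ A := by
    rw [pairIdx_mem_fullPairs, and_iff_right ht]
  rw [Finset.prod_ite_eq', hfull]
  by_cases h : pairIdx t ∈ fullPairs A
  · rw [if_pos (Finset.mem_erase.2 ⟨hne, hmem.1 h⟩), ← Finset.card_erase_add_one h, pow_succ]
    ring
  · rw [if_neg fun h' => h (hmem.2 (Finset.mem_of_mem_erase h')), Finset.erase_eq_of_notMem h, one_mul]

theorem xy_sdiff_pair (A B : Finset (Fin (2 * n))) (t u : Fin (2 * n)) :
    xy A B \ {xi n t, yi n u} = xy (A.erase t) (B.erase u) := by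
  apply ext_xi_yi <;> intro a <;>
  simp only [Finset.mem_sdiff, xi_mem_xy, yi_mem_xy, Finset.mem_insert, Finset.mem_singleton,
    Finset.mem_erase, xi_injective.eq_iff, yi_injective.eq_iff, (xi_lt_yi _ _).ne,
    (xi_lt_yi _ _).ne', or_false, false_or, and_comm]

theorem kerSign_erase {A : Finset (Fin (2 * n))} {t : Fin (2 * n)} (ht : t ∈ A) :
    (-1) ^ (t : ℕ) * (Gr.msign (xy (A.erase t) (swapPairs (A.erase t))) {xi n t, yi n (partner t)} *
      kerSign (A.erase t)) = kerSign A := by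
  have hsign : (Gr.msign (xy (A.erase t) (swapPairs (A.erase t))) {xi n t, yi n (partner t)} : ℂ) =
      (-1) ^ (A.erase t).card * ∏ u ∈ A.erase t, if u = partner t then (-1 : ℂ) else 1 := by
    rw [Gr.msign_eq_prod, prod_xy, prod_swapPairs, ← Finset.prod_const, ← Finset.prod_mul_distrib,
      ← Finset.prod_mul_distrib]
    refine Finset.prod_congr rfl fun u hu => ?_
    rw [Finset.prod_pair (xi_lt_yi _ _).ne, Finset.prod_pair (xi_lt_yi _ _).ne]
    have hut := Finset.ne_of_mem_erase hu
    simp only [xi_lt_xi, yi_lt_yi, not_yi_lt_xi, xi_lt_yi, if_true, if_false]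
    have h : (u = partner t ∧ (t < u ↔ ¬ partner t < partner u)) ∨
        (u ≠ partner t ∧ (t < u ↔ partner t < partner u)) := by
      simp only [partner, ne_eq, Fin.ext_iff, Fin.lt_def] at *
      split_ifs <;> omega
    rcases h with ⟨h, h'⟩ | ⟨h, h'⟩
    · by_cases h'' : t < u
      · rw [if_pos h'', if_neg (h'.1 h''), if_pos h]
        ring
      · rw [if_neg h'', if_pos (not_not.1 (mt h'.2 h'')), if_pos h]
        ring
    · by_cases h'' : t < u
      · rw [if_pos h'', if_pos (h'.1 h''), if_neg h]
        ring
      · rw [if_neg h'', if_neg (mt h'.2 h''), if_neg h]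
        ring
  set Y : ℂ := ∏ p ∈ A.erase t, if t < p then (-1 : ℂ) else 1 with hY
  set Z : ℂ := ∏ q ∈ Aᶜ, if q < t then (-1 : ℂ) else 1 with hZ
  set X : ℂ := ∏ p ∈ A.erase t, ∏ q ∈ Aᶜ, if q < p then (-1 : ℂ) else 1 with hX
  have hA : (Gr.msign A Aᶜ : ℂ) = Z * X := by
    rw [Gr.msign_eq_prod, ← Finset.mul_prod_erase A _ ht]
  have hA' : (Gr.msign (A.erase t) (A.erase t)ᶜ : ℂ) = Y * X := by
    rw [Gr.msign_eq_prod, hY, hX, ← Finset.prod_mul_distrib]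
    refine Finset.prod_congr rfl fun p _ => ?_
    rw [Finset.compl_erase, Finset.prod_insert (by simpa using ht)]
  have hYY : Y * Y = 1 := by
    rw [hY, ← Finset.prod_mul_distrib]
    exact Finset.prod_eq_one fun p _ => by split_ifs <;> ring
  have hZY : Z * Y = (-1) ^ (t : ℕ) * (-1) ^ (A.erase t).card := prod_lt_mul_prod_lt A t
  rw [hsign, kerSign, kerSign, hA, hA', ← neg_one_pow_card_fullPairs_erase ht]
  linear_combination (-Y * X * (∏ u ∈ A.erase t, if u = partner t then (-1 : ℂ) else 1) *
    (-1) ^ (fullPairs (A.erase t)).card) * hZY + (Z * X *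
    (∏ u ∈ A.erase t, if u = partner t then (-1 : ℂ) else 1) *
    (-1) ^ (fullPairs (A.erase t)).card) * hYY

/-- The bilinear form `Σ_j (x_{2j-1} y_{2j} - x_{2j} y_{2j-1})`. -/
def symplecticForm (n : ℕ) : Gr ℂ (2 * n + 2 * n) :=
  ∑ j : Fin n, (Gr.mul (Gr.gen (xi n (lo n j))) (Gr.gen (yi n (hi n j))) -
    Gr.mul (Gr.gen (xi n (hi n j))) (Gr.gen (yi n (lo n j))))

theorem symplecticForm_eq_sum : symplecticForm n = ∑ t : Fin (2 * n), (-1 : ℂ) ^ (t : ℕ) •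
    Gr.mul (Gr.gen (xi n t)) (Gr.gen (yi n (partner t))) := by
  rw [sum_eq_sum_lo_add_hi, symplecticForm]
  refine Finset.sum_congr rfl fun j _ => ?_
  rw [partner_lo, partner_hi]
  simp [lo, hi, pow_succ, sub_eq_add_neg]

theorem pow_symplecticForm_apply (k : ℕ) (A B : Finset (Fin (2 * n))) :
    Gr.pow (symplecticForm n) k (xy A B) =
      if B = swapPairs A ∧ A.card = k then k.factorial * kerSign A else 0 := by
  induction k generalizing A B with
  | zero =>
    simp only [Gr.pow, Gr.one, Nat.factorial_zero, Nat.cast_one, Finset.card_eq_zero]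
    by_cases hA : A = ∅
    · subst hA
      by_cases hB : B = ∅
      · subst hB
        simp [xy, kerSign, swapPairs, fullPairs, Gr.msign]
      · simp [xy, swapPairs, hB]
    · simp [xy, hA]
  | succ k ih =>
    rw [Gr.pow, congrArg (Gr.mul (Gr.pow (symplecticForm n) k)) symplecticForm_eq_sum, Gr.mul_sum,
      Finset.sum_apply]
    have hterm : ∀ t : Fin (2 * n),
        Gr.mul (Gr.pow (symplecticForm n) k)
          ((-1 : ℂ) ^ (t : ℕ) • Gr.mul (Gr.gen (xi n t)) (Gr.gen (yi n (partner t)))) (xy A B) =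
          if t ∈ A then
            (if B = swapPairs A ∧ A.card = k + 1 then (k.factorial : ℂ) * kerSign A else 0)
          else 0 := by
      intro t
      rw [Gr.mul_smul, Pi.smul_apply, smul_eq_mul, Gr.mul_gen_mul_gen_apply _ (xi_lt_yi _ _),
        xy_sdiff_pair, ih]
      simp only [xi_mem_xy, yi_mem_xy]
      by_cases ht : t ∈ A
      · have hcard := Finset.card_erase_add_one ht
        by_cases hB : B = swapPairs A
        · subst hB
          rw [← swapPairs_erase, if_pos (by simpa using ht), if_pos ht, ← kerSign_erase ht]
          by_cases hk : A.card = k + 1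
          · rw [if_pos ⟨rfl, by omega⟩, if_pos ⟨rfl, hk⟩]
            ring
          · rw [if_neg (by omega), if_neg (by omega), mul_zero, mul_zero]
        · rw [if_pos ht, if_neg (c := B = _ ∧ _) (by tauto)]
          split_ifs with h1 h2
          · refine absurd ?_ hB
            rw [← Finset.insert_erase h1.2, h2.1, swapPairs_erase, Finset.insert_erase]
            simpa using ht
          · simp
          · simp
      · simp [ht]
    rw [Finset.sum_congr rfl fun j _ => hterm j, Finset.sum_ite_mem, Finset.univ_inter,
      Finset.sum_const, nsmul_eq_mul]
    split_ifs with h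
    · rw [h.2, Nat.factorial_succ]
      push_cast
      ring
    · simp

theorem fermK_apply (σ : ℂ) (A B : Finset (Fin (2 * n))) :
    fermK n σ (xy A B) =
      if B = swapPairs A then (-σ * (Complex.I / 2)) ^ A.card * kerSign A else 0 := by
  rw [fermK, ← symplecticForm, Gr.gexp]
  simp only [Gr.smul_pow, Finset.sum_apply, Pi.smul_apply, smul_eq_mul, pow_symplecticForm_apply]
  split_ifs with h
  · rw [Finset.sum_eq_single A.card]
    · have : (A.card.factorial : ℂ) ≠ 0 := by exact_mod_cast Nat.factorial_ne_zero _
      rw [if_pos ⟨h, rfl⟩]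
      field_simp
    · intro k _ hk
      rw [if_neg fun h' => hk h'.2.symm, mul_zero, mul_zero]
    · intro hk
      have := A.card_le_univ
      simp only [Fintype.card_fin] at this
      simp only [Finset.mem_range] at hk
      omega
  · simp [h]

theorem mul_fermK_embX_apply (σ : ℂ) (g : Gr ℂ (2 * n)) (S : Finset (Fin (2 * n))) :
    Gr.mul (fermK n σ) (embX n g) (xy Finset.univ S) =
      (σ * Complex.I / 2) ^ S.card * (-1) ^ (fullPairs S).card * g (swapPairs S)ᶜ := by
  have hterm : ∀ C : Finset (Fin (2 * n)), ∑ B ∈ (xy Finset.univ S).powerset,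
      (Gr.msign (xy Finset.univ S \ B) B : ℂ) * fermK n σ (xy Finset.univ S \ B) *
        (if B = C.image (xi n) then g C else 0) =
      (Gr.msign (xy Cᶜ S) (C.image (xi n)) : ℂ) * fermK n σ (xy Cᶜ S) * g C := by
    intro C
    rw [Finset.sum_eq_single (C.image (xi n))]
    · have : xy Finset.univ S \ C.image (xi n) = xy Cᶜ S := by
        apply ext_xi_yi <;> intro a <;>
        simp only [Finset.mem_sdiff, xi_mem_xy, yi_mem_xy, Finset.mem_image, xi_injective.eq_iff,
          exists_eq_right, (xi_lt_yi _ _).ne, Finset.mem_compl, Finset.mem_univ, and_false,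
          exists_false, not_false_iff, and_true, true_and]
      rw [if_pos rfl, this]
    · intro B _ hB
      rw [if_neg hB, mul_zero]
    · intro h
      refine absurd (Finset.mem_powerset.2 ?_) h
      exact (Finset.image_subset_image (Finset.subset_univ C)).trans Finset.subset_union_left
  rw [Gr.mul_apply_eq_sum_right]
  simp only [embX, Finset.mul_sum]
  rw [Finset.sum_comm]
  simp only [hterm]
  rw [Finset.sum_eq_single (swapPairs S)ᶜ]
  · set A := swapPairs S with hA
    have hS : S = swapPairs A := by simp [hA]
    have hcard : A.card = S.card := by simp [hA]
    have hsign : (Gr.msign (xy A S) (Aᶜ.image (xi n)) : ℂ) =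
        Gr.msign A Aᶜ * ((-1) ^ Aᶜ.card) ^ S.card := by
      rw [Gr.msign_eq_prod, prod_xy, Gr.msign_eq_prod]
      simp only [Finset.prod_image xi_injective.injOn, xi_lt_xi, xi_lt_yi, if_true,
        Finset.prod_const]
    have hsq : (Gr.msign A Aᶜ : ℂ) * Gr.msign A Aᶜ = 1 := by
      rw [Gr.msign, ← mul_pow]
      simp
    have hpow : ((-1 : ℂ) ^ Aᶜ.card) ^ S.card = (-1) ^ S.card := by
      rw [Finset.card_compl, Fintype.card_fin, hcard, ← pow_mul]
      have hle : S.card ≤ 2 * n := by simpa using S.card_le_univ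
      obtain ⟨m, hm⟩ := Nat.exists_eq_add_of_le hle
      have hm' : 2 * n - S.card = m := by omega
      rw [hm']
      rcases Nat.even_or_odd m with h | h
      · have : Even S.card := by grind
        rw [(h.mul_right _).neg_one_pow, this.neg_one_pow]
      · have : Odd S.card := by grind
        rw [(h.mul this).neg_one_pow, this.neg_one_pow]
    have hfull : fullPairs S = fullPairs A := by rw [hA, fullPairs_swapPairs]
    have hneg : (-σ * (Complex.I / 2)) ^ S.card = (-1) ^ S.card * (σ * Complex.I / 2) ^ S.card := by
      rw [← mul_pow]
      ring
    have hone : (-1 : ℂ) ^ S.card * (-1) ^ S.card = 1 := by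
      rw [← mul_pow]
      simp
    rw [compl_compl, hsign, hpow, fermK_apply, if_pos hS, hcard, kerSign, hneg, hfull]
    linear_combination ((σ * Complex.I / 2) ^ S.card * (-1) ^ (fullPairs A).card * g Aᶜ) *
      ((-1 : ℂ) ^ S.card * (-1) ^ S.card * hsq + hone)
  · intro C _ hC
    rw [fermK_apply, if_neg, mul_zero, zero_mul]
    rintro rfl
    exact hC (by simp)
  · simp

theorem fermFT_apply (σ : ℂ) (g : Gr ℂ (2 * n)) (S : Finset (Fin (2 * n))) :
    fermFT n σ g S = 2 ^ n * ((σ * Complex.I / 2) ^ S.card * (-1) ^ (fullPairs S).card *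
      g (swapPairs S)ᶜ) := by
  have hlist : ((List.finRange (2 * n)).map (xi n)).toFinset ∪ S.image (yi n) =
      xy Finset.univ S := by
    apply ext_xi_yi <;> intro a <;>
    simp [xi_injective.eq_iff, yi_injective.eq_iff, (xi_lt_yi _ _).ne, (xi_lt_yi _ _).ne']
  rw [fermFT, berezinX, Pi.smul_apply, Gr.derivList_apply_of_sorted, hlist, mul_fermK_embX_apply,
    smul_eq_mul]
  · have : (Real.pi : ℂ) ≠ 0 := by exact_mod_cast Real.pi_ne_zero
    push_cast
    rw [mul_pow]
    field_simp
  · rw [List.pairwise_map]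
    exact List.pairwise_lt_finRange _
  · intro a ha b hb
    obtain ⟨a, _, rfl⟩ := List.mem_map.1 ha
    obtain ⟨b, _, rfl⟩ := Finset.mem_image.1 hb
    exact xi_lt_yi a b

end Kernel

section Harmonic

theorem sum_powerset_sdiff_eq {α : Type*} [DecidableEq α] {h : Finset α → ℂ} {M P : Finset α}
    {k : ℕ} (hP : P ⊆ M) (hcard : ∀ Q ⊆ M, Q.card ≠ k → h Q = 0)
    (hdown : ∀ R ⊆ M, ∑ j ∈ M \ R, h (insert j R) = 0) :
    ∑ Q ∈ (M \ P).powerset, h Q = (-1) ^ k * ∑ Q ∈ P.powerset, h Q := by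
  have htop : ∀ T ⊆ M, k ≤ T.card → ∑ Q ∈ M.powerset, (if T ⊆ Q then h Q else 0) = h T := by
    intro T hT hk
    rw [Finset.sum_eq_single_of_mem T (Finset.mem_powerset.2 hT), if_pos subset_rfl]
    intro Q hQ hne
    split_ifs with hTQ
    · have := Finset.card_lt_card (hTQ.ssubset_of_ne hne.symm)
      exact hcard Q (Finset.mem_powerset.1 hQ) (by omega)
    · rfl
  have hstep : ∀ T ⊆ M, ∑ j ∈ M \ T, ∑ Q ∈ M.powerset, (if insert j T ⊆ Q then h Q else 0) =
      ((k : ℂ) - T.card) * ∑ Q ∈ M.powerset, (if T ⊆ Q then h Q else 0) := by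
    intro T hT
    rw [Finset.sum_comm, Finset.mul_sum]
    refine Finset.sum_congr rfl fun Q hQ => ?_
    rw [Finset.mem_powerset] at hQ
    by_cases hTQ : T ⊆ Q
    · simp only [Finset.insert_subset_iff, hTQ, and_true, if_true]
      by_cases hk : Q.card = k
      · have : {j ∈ M \ T | j ∈ Q} = Q \ T := by
          ext j
          have := @hQ j
          simp only [Finset.mem_filter, Finset.mem_sdiff]
          tauto
        rw [← Finset.sum_filter, this, Finset.sum_const, Finset.card_sdiff_of_subset hTQ,
          nsmul_eq_mul, Nat.cast_sub (Finset.card_le_card hTQ), hk]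
      · simp [hcard Q hQ hk]
    · simp [Finset.insert_subset_iff, hTQ]
  have hbot : ∀ d : ℕ, ∀ T ⊆ M, T.card + (d + 1) = k →
      ∑ Q ∈ M.powerset, (if T ⊆ Q then h Q else 0) = 0 := by
    intro d
    induction d with
    | zero =>
      intro T hT hd
      have h1 := hstep T hT
      rw [← hd, Finset.sum_congr rfl fun j hj => htop (insert j T) ?_ ?_, hdown T hT] at h1
      · simpa using h1.symm
      · exact Finset.insert_subset (Finset.mem_sdiff.1 hj).1 hT
      · rw [Finset.card_insert_of_notMem (Finset.mem_sdiff.1 hj).2]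
        omega
    | succ d ih =>
      intro T hT hd
      have h1 := hstep T hT
      rw [← hd, Finset.sum_eq_zero fun j hj => ih (insert j T) ?_ ?_] at h1
      · have : ((d : ℂ) + 1 + 1) ≠ 0 := by exact_mod_cast (Nat.succ_ne_zero (d + 1))
        push_cast at h1
        rw [add_sub_cancel_left] at h1
        exact (mul_eq_zero.1 h1.symm).resolve_left this
      · exact Finset.insert_subset (Finset.mem_sdiff.1 hj).1 hT
      · rw [Finset.card_insert_of_notMem (Finset.mem_sdiff.1 hj).2]
        omega
  have hie : ∀ Q : Finset α, ∑ T ∈ P.powerset, (if T ⊆ Q then (-1 : ℂ) ^ T.card else 0) =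
      if Q ∩ P = ∅ then 1 else 0 := by
    intro Q
    have : {T ∈ P.powerset | T ⊆ Q} = (Q ∩ P).powerset := by
      ext T
      simp only [Finset.mem_filter, Finset.mem_powerset, Finset.subset_inter_iff, and_comm]
    rw [← Finset.sum_filter, this]
    exact_mod_cast congrArg (Int.cast : ℤ → ℂ) (Finset.sum_powerset_neg_one_pow_card (x := Q ∩ P))
  calc ∑ Q ∈ (M \ P).powerset, h Q
      = ∑ Q ∈ M.powerset, (if Q ∩ P = ∅ then 1 else 0) * h Q := by
        simp only [ite_mul, one_mul, zero_mul, ← Finset.sum_filter]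
        refine Finset.sum_congr ?_ fun _ _ => rfl
        ext Q
        simp only [Finset.mem_powerset, Finset.mem_filter, Finset.subset_sdiff,
          Finset.disjoint_iff_inter_eq_empty]
    _ = ∑ T ∈ P.powerset, (-1) ^ T.card * ∑ Q ∈ M.powerset, (if T ⊆ Q then h Q else 0) := by
        simp only [← hie, Finset.sum_mul, Finset.mul_sum]
        rw [Finset.sum_comm]
        simp only [ite_mul, zero_mul, mul_ite, mul_zero]
    _ = (-1) ^ k * ∑ Q ∈ P.powerset, h Q := by
        rw [Finset.mul_sum]
        refine Finset.sum_congr rfl fun T hT => ?_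
        have hTM := (Finset.mem_powerset.1 hT).trans hP
        rcases lt_trichotomy T.card k with hk | hk | hk
        · rw [hbot (k - T.card - 1) T hTM (by omega), hcard T hTM hk.ne, mul_zero, mul_zero]
        · rw [htop T hTM hk.ge, hk]
        · rw [htop T hTM hk.le, hcard T hTM hk.ne', mul_zero, mul_zero]

variable {n : ℕ}

theorem lapF_apply (H : Gr ℂ (2 * n)) (u : Finset (Fin (2 * n))) :
    lapF n H u = -4 * ∑ j ∈ fullPairs uᶜ, H (u ∪ pairs {j}) := by
  have hterm : ∀ j : Fin n, Gr.pderiv (lo n j) (Gr.pderiv (hi n j) H) u =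
      if j ∈ fullPairs uᶜ then -H (u ∪ pairs {j}) else 0 := by
    intro j
    simp only [Gr.pderiv, mem_fullPairs, Finset.mem_compl, Finset.mem_insert,
      (lo_lt_hi j).ne', false_or]
    by_cases hl : lo n j ∈ u
    · simp [hl]
    by_cases hh : hi n j ∈ u
    · simp [hl, hh]
    have hins : insert (hi n j) (insert (lo n j) u) = u ∪ pairs {j} := by
      rw [pairs_singleton]
      ext t
      simp only [Finset.mem_insert, Finset.mem_union, Finset.mem_singleton]
      tauto
    have hfilter : {i ∈ u | i < hi n j} = {i ∈ u | i < lo n j} := by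
      refine Finset.filter_congr fun i hi' => ?_
      have : i ≠ lo n j := fun e => hl (e ▸ hi')
      simp only [lo, hi, Fin.lt_def, ne_eq, Fin.ext_iff] at this ⊢
      omega
    rw [if_neg hl, if_neg hh, if_pos ⟨hl, hh⟩, hins, Finset.filter_insert, if_pos (lo_lt_hi j),
      Finset.card_insert_of_notMem (by simp [hl]), hfilter, pow_succ]
    have : (-1 : ℂ) ^ (Finset.filter (fun i => i < lo n j) u).card *
        (-1) ^ (Finset.filter (fun i => i < lo n j) u).card = 1 := by
      rw [← mul_pow]
      simp
    linear_combination (-H (u ∪ pairs {j})) * this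
  rw [lapF, Pi.smul_apply, Finset.sum_apply, Finset.sum_congr rfl fun j _ => hterm j,
    Finset.sum_ite_mem, Finset.univ_inter, Finset.sum_neg_distrib, smul_eq_mul]
  ring

theorem card_union_pairs {u : Finset (Fin (2 * n))} {Q : Finset (Fin n)}
    (hQ : Q ⊆ fullPairs uᶜ) : (u ∪ pairs Q).card = u.card + 2 * Q.card := by
  rw [Finset.card_union_of_disjoint, card_pairs]
  exact Finset.disjoint_left.2 fun t ht ht' =>
    Finset.mem_compl.1 (pairs_subset_iff.2 hQ ht') ht

theorem sum_pairs_sdiff_of_harmonic {H : Gr ℂ (2 * n)} {l k : ℕ}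
    (hhom : ∀ s : Finset (Fin (2 * n)), s.card ≠ l → H s = 0) (hharm : lapF n H = 0)
    {u : Finset (Fin (2 * n))} (hk : u.card + 2 * k = l) {P : Finset (Fin n)}
    (hP : P ⊆ fullPairs uᶜ) :
    ∑ Q ∈ (fullPairs uᶜ \ P).powerset, H (u ∪ pairs Q) =
      (-1) ^ k * ∑ Q ∈ P.powerset, H (u ∪ pairs Q) := by
  refine sum_powerset_sdiff_eq (h := fun Q => H (u ∪ pairs Q)) hP (fun Q hQ hne => ?_)
    fun R hR => ?_
  · refine hhom _ ?_
    rw [card_union_pairs hQ]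
    omega
  · have h := congrFun hharm (u ∪ pairs R)
    rw [lapF_apply, Pi.zero_apply] at h
    have hset : fullPairs (u ∪ pairs R)ᶜ = fullPairs uᶜ \ R := by
      rw [← fullPairs_sdiff_pairs, Finset.compl_union, Finset.sdiff_eq_inter_compl]
    rw [hset] at h
    refine Eq.trans (Finset.sum_congr rfl fun j _ => ?_)
      ((mul_eq_zero.1 h).resolve_left (by norm_num))
    congr 1
    ext t
    simp only [Finset.mem_union, mem_pairs, Finset.mem_insert, Finset.mem_singleton]
    tauto

/-- On a homogeneous element all the Gaussian weights in a coefficient coincide. -/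
theorem mul_fermGauss_apply_of_homogeneous {H : Gr ℂ (2 * n)} {l k : ℕ}
    (hhom : ∀ s : Finset (Fin (2 * n)), s.card ≠ l → H s = 0) {s : Finset (Fin (2 * n))}
    (hk : (s \ pairs (fullPairs s)).card + 2 * k = l) :
    Gr.mul H (fermGauss n) s = 2 ^ k / 2 ^ (fullPairs s).card *
      ∑ Q ∈ (fullPairs s).powerset, H (s \ pairs (fullPairs s) ∪ pairs Q) := by
  rw [mul_fermGauss_apply, Finset.mul_sum]
  refine Finset.sum_congr rfl fun Q hQ => ?_
  rw [Finset.mem_powerset] at hQ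
  by_cases hQk : Q.card = k
  · have hcard := Finset.card_sdiff_add_card_eq_card hQ
    rw [← hcard, hQk, pow_add]
    field_simp
  · rw [hhom (_ ∪ _), mul_zero, mul_zero]
    rw [card_union_pairs]
    · omega
    · refine hQ.trans fun j hj => ?_
      simp only [mem_fullPairs] at hj
      simp [hj]

theorem compl_swapPairs_sdiff (s : Finset (Fin (2 * n))) :
    (swapPairs s)ᶜ \ pairs (fullPairs (swapPairs s)ᶜ) = s \ pairs (fullPairs s) := by
  ext t
  simp only [Finset.mem_sdiff, mem_pairs, pairIdx_mem_fullPairs, Finset.mem_compl, mem_swapPairs,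
    partner_partner]
  tauto

theorem fullPairs_compl_swapPairs (s : Finset (Fin (2 * n))) :
    fullPairs (swapPairs s)ᶜ = fullPairs (s \ pairs (fullPairs s))ᶜ \ fullPairs s := by
  ext j
  simp only [mem_fullPairs, Finset.mem_sdiff, Finset.mem_compl, mem_swapPairs, mem_pairs,
    partner_lo, partner_hi, pairIdx_lo, pairIdx_hi]
  tauto

theorem card_sdiff_pairs_fullPairs (s : Finset (Fin (2 * n))) :
    (s \ pairs (fullPairs s)).card + 2 * (fullPairs s).card = s.card := by
  rw [← card_pairs, Finset.card_sdiff_add_card_eq_card (pairs_subset_iff.2 subset_rfl)]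

end Harmonic

/-- Let `H ∈ Λ_{2n}` be a fermionic spherical harmonic of degree `l` (homogeneous of
degree `l` and annihilated by `Δ_f`, with `0 ≤ l ≤ n`).  Then
`F^±_{0|2n}(H(x) exp(x`²/2))(y) = (±i)^l H(y) exp(y`²/2)` (sign `σ = ±1`). -/
theorem fermFT_spherical_harmonic (n l : ℕ) (hl : l ≤ n) (H : Gr ℂ (2 * n))
    (hhom : ∀ s : Finset (Fin (2 * n)), s.card ≠ l → H s = 0)
    (hharm : lapF n H = 0) (σ : ℂ) (hσ : σ = 1 ∨ σ = -1) :
    fermFT n σ (Gr.mul H (fermGauss n)) =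
      (σ * Complex.I) ^ l • Gr.mul H (fermGauss n) := by
  ext s
  rw [fermFT_apply, Pi.smul_apply, smul_eq_mul]
  set u := s \ pairs (fullPairs s) with hu
  have hP : fullPairs s ⊆ fullPairs uᶜ := fun j hj => by
    have := mem_fullPairs.1 hj
    simp [hu, this]
  have hu' : (swapPairs s)ᶜ \ pairs (fullPairs (swapPairs s)ᶜ) = u := compl_swapPairs_sdiff s
  by_cases hk : ∃ k, u.card + 2 * k = l
  · obtain ⟨k, hk⟩ := hk
    rw [mul_fermGauss_apply_of_homogeneous hhom hk,
      mul_fermGauss_apply_of_homogeneous hhom (hu'.symm ▸ hk), hu', ← hu,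
      congrArg Finset.powerset (fullPairs_compl_swapPairs s),
      sum_pairs_sdiff_of_harmonic hhom hharm hk hP, ← hk]
    have h1 := card_sdiff_pairs_fullPairs s
    have h2 := card_sdiff_pairs_fullPairs (swapPairs s)ᶜ
    have h3 := s.card_le_univ
    rw [hu', Finset.card_compl, card_swapPairs, Fintype.card_fin] at h2
    rw [Fintype.card_fin] at h3
    rw [← hu] at h1
    generalize hT : ∑ Q ∈ (fullPairs s).powerset, H (u ∪ pairs Q) = T
    generalize (fullPairs (swapPairs s)ᶜ).card = e at *
    generalize (fullPairs s).card = p at *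
    have hn : 2 ^ n = (2 : ℂ) ^ (u.card + p + e) := by
      congr 1
      omega
    have hσI : (σ * Complex.I) ^ 2 = -1 := by
      rcases hσ with rfl | rfl <;> simp
    have hone : (-1 : ℂ) ^ p * (-1) ^ p = 1 := by
      rw [← mul_pow]
      simp
    have hp : (2 : ℂ) ^ (2 * p) = 2 ^ p * 2 ^ p := by rw [two_mul, pow_add]
    rw [hn, ← h1, div_pow, pow_add (σ * Complex.I), pow_add (σ * Complex.I), pow_mul, pow_mul, hσI,
      pow_add, pow_add, pow_add, hp]
    field_simp
    linear_combination ((σ * Complex.I) ^ u.card * T) * hone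
  · have hzero : ∀ Q ⊆ fullPairs uᶜ, H (u ∪ pairs Q) = 0 := fun Q hQ =>
      hhom _ (by rw [card_union_pairs hQ]; exact fun h => hk ⟨_, h⟩)
    rw [mul_fermGauss_apply, mul_fermGauss_apply, hu', ← hu, Finset.sum_eq_zero,
      Finset.sum_eq_zero]
    · simp
    · intro Q hQ
      rw [hzero Q ((Finset.mem_powerset.1 hQ).trans hP), mul_zero]
    · intro Q hQ
      rw [Finset.mem_powerset, fullPairs_compl_swapPairs] at hQ
      rw [hzero Q (hQ.trans Finset.sdiff_subset), mul_zero]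
end

section
/- Inversion theorem for the super Fourier transform: F^+_{m|2n} ∘ F^−_{m|2n} = id and F^−_{m|2n} ∘ F^+_{m|2n} = id on S(ℝ^m)_{m|2n}; consequently F^±_{m|2n} is a linear isomorphism of S(ℝ^m)_{m|2n}. -/
open scoped BigOperators
open Finset MeasureTheory

noncomputable section

/-- Functions on `ℝ^m` with values in the Grassmann algebra `Λ_{2n}`; the elements with
Schwartz coefficients form the space `S(ℝ^m)_{m|2n}`. -/
abbrev SF (m n : ℕ) : Type := ((Fin m) → ℝ) → Gr ℂ (2 * n)

/-- `f ∈ S(ℝ^m)_{m|2n}`: every Grassmann coefficient of `f` is a Schwartz function. -/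
def IsSchwartz (m n : ℕ) (f : SF m n) : Prop :=
  ∀ s : Finset (Fin (2 * n)), ∃ φ : SchwartzMap ((Fin m) → ℝ) ℂ, ∀ x, f x s = φ x

/-- The super Fourier transform
`F^σ_{m|2n}(f)(y) = (2π)^{-M/2} ∫_{ℝ^m} dV(x) ∫_{B,x} exp(σ i Σ_i x_i y_i) K^σ(x,y) f(x)`,
with `M = m - 2n` (plus sign: `σ = 1`; minus sign: `σ = -1`). -/
def superFT (m n : ℕ) (σ : ℂ) (f : SF m n) : SF m n :=
  fun y s => (((2 * Real.pi : ℝ) : ℂ) ^ ((-((m : ℂ) - 2 * (n : ℂ))) / 2)) *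
    ∫ x : (Fin m) → ℝ, Complex.exp (σ * Complex.I * ∑ i, (x i : ℂ) * (y i : ℂ)) *
      berezinX n (Gr.mul (fermK n σ) (embX n (f x))) (s.image (yi n))

/-- The partial derivative `∂_{x_i}` of a `Λ_{2n}`-valued function, acting coefficientwise. -/
def bderiv (m n : ℕ) (i : Fin m) (f : SF m n) : SF m n :=
  fun x s => fderiv ℝ (fun t => f t s) x (Pi.single i 1)

/-- The super Laplace operator `Δ = 4 Σ_j ∂_{x`_{2j-1}} ∂_{x`_{2j}} - Σ_j ∂_{x_j}²`. -/
def superLap (m n : ℕ) (f : SF m n) : SF m n :=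
  fun x => lapF n (f x) - ∑ i : Fin m, bderiv m n i (bderiv m n i f) x

/-- The element `x² = Σ_{j=1}^n x`_{2j-1} x`_{2j} - Σ_{j=1}^m x_j²` at the point `x`. -/
def xsqElem (m n : ℕ) (x : (Fin m) → ℝ) : Gr ℂ (2 * n) :=
  xsq n + (-(∑ i : Fin m, ((x i : ℂ)) ^ 2)) • Gr.one

/-- The super Gaussian `exp(x²/2) = exp(-(x_1²+⋯+x_m²)/2) Σ_{j=0}^n (x`²)^j/(2^j j!)`. -/
def gaussFun (m n : ℕ) : SF m n :=
  fun x => ((Real.exp (-(∑ i : Fin m, (x i) ^ 2) / 2) : ℝ) : ℂ) • fermGauss n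

/-- The Euler operator `𝔼 = Σ_j x_j ∂_{x_j} + Σ_j x`_j ∂_{x`_j}`. -/
def euler (m n : ℕ) (f : SF m n) : SF m n :=
  fun x => (∑ i : Fin m, ((x i : ℂ)) • bderiv m n i f x) +
    ∑ t : Fin (2 * n), Gr.mul (Gr.gen t) (Gr.pderiv t (f x))

/-- The super integral `∫_{ℝ^{m|2n}} f = ∫_{ℝ^m} dV(x) ∫_B f`. -/
def superInt (m n : ℕ) (f : SF m n) : ℂ := ∫ x : (Fin m) → ℝ, berezin n (f x)

end

namespace SuperFourier
open scoped FourierTransform SchwartzMap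

/-- The bosonic Fourier integral `∫ exp(σ i x·y) h(x) dx`, without normalisation. -/
noncomputable def bosFT {m : ℕ} (σ : ℂ) (h : (Fin m → ℝ) → ℂ) (y : Fin m → ℝ) : ℂ :=
  ∫ x : Fin m → ℝ, Complex.exp (σ * Complex.I * ∑ i, (x i : ℂ) * (y i : ℂ)) * h x

theorem bosFT_const_mul {m : ℕ} (σ c : ℂ) (h : (Fin m → ℝ) → ℂ) (y : Fin m → ℝ) :
    bosFT σ (fun x => c * h x) y = c * bosFT σ h y := by
  unfold bosFT
  rw [← integral_const_mul]
  exact integral_congr_ae (.of_forall fun x => by ring)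

theorem bosFT_comp_toLp {m : ℕ} (ε : ℝ) (φ : EuclideanSpace ℝ (Fin m) → ℂ) (y : Fin m → ℝ) :
    bosFT (ε : ℂ) (fun x => φ (WithLp.toLp 2 x)) y =
      𝓕⁻ φ (WithLp.toLp 2 ((ε / (2 * Real.pi)) • y)) := by
  rw [Real.fourierInv_eq', bosFT,
    ← (PiLp.volume_preserving_toLp (Fin m)).integral_comp
      (MeasurableEquiv.toLp 2 (Fin m → ℝ)).measurableEmbedding]
  refine integral_congr_ae (.of_forall fun x => ?_)
  have hpi : (Real.pi : ℂ) ≠ 0 := by exact_mod_cast Real.pi_ne_zero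
  simp only [smul_eq_mul]
  congr 2
  simp only [PiLp.inner_apply, Pi.smul_apply, smul_eq_mul, RCLike.inner_apply, conj_trivial]
  push_cast
  rw [Finset.mul_sum, Finset.mul_sum, Finset.sum_mul]
  refine Finset.sum_congr rfl fun i _ => ?_
  field_simp

/-- Schwartz functions on `Fin m → ℝ` transported to Euclidean space. -/
noncomputable def toEuclid {m : ℕ} (φ : 𝓢(Fin m → ℝ, ℂ)) : 𝓢(EuclideanSpace ℝ (Fin m), ℂ) :=
  SchwartzMap.compCLMOfContinuousLinearEquiv ℂ (EuclideanSpace.equiv (Fin m) ℝ) φ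

theorem bosFT_eq_fourierInv {m : ℕ} (ε : ℝ) (φ : 𝓢(Fin m → ℝ, ℂ)) (y : Fin m → ℝ) :
    bosFT (ε : ℂ) φ y = 𝓕⁻ (toEuclid φ) (WithLp.toLp 2 ((ε / (2 * Real.pi)) • y)) := by
  rw [SchwartzMap.fourierInv_coe, ← bosFT_comp_toLp]
  rfl

theorem exists_schwartz_bosFT {m : ℕ} {ε : ℝ} (hε : ε ≠ 0) (φ : 𝓢(Fin m → ℝ, ℂ)) :
    ∃ ψ : 𝓢(Fin m → ℝ, ℂ), ∀ y, bosFT (ε : ℂ) φ y = ψ y := by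
  have hc : ε / (2 * Real.pi) ≠ 0 := div_ne_zero hε (by positivity)
  refine ⟨SchwartzMap.compCLMOfContinuousLinearEquiv ℂ
    ((ContinuousLinearEquiv.smulLeft (R₁ := ℝ) (Units.mk0 _ hc)).trans
      (EuclideanSpace.equiv (Fin m) ℝ).symm) (𝓕⁻ (toEuclid φ)), fun y => ?_⟩
  rw [bosFT_eq_fourierInv]
  rfl

theorem bosFT_bosFT_neg {m : ℕ} {ε : ℝ} (hε : |ε| = 1) (φ : 𝓢(Fin m → ℝ, ℂ)) (y : Fin m → ℝ) :
    bosFT (ε : ℂ) (bosFT (-ε : ℂ) φ) y = ((2 * Real.pi : ℝ) : ℂ) ^ m * φ y := by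
  have h1 : bosFT (-ε : ℂ) φ = fun x =>
      𝓕 (toEuclid φ) (WithLp.toLp 2 ((ε / (2 * Real.pi)) • x)) := by
    funext x
    have := bosFT_eq_fourierInv (-ε) φ x
    push_cast at this
    rw [this, SchwartzMap.fourierInv_coe, SchwartzMap.fourier_coe, Real.fourierInv_eq_fourier_neg]
    refine congrArg _ ?_
    ext i
    simp [neg_div]
  have h2 : bosFT (ε : ℂ) (bosFT (-ε : ℂ) φ) y =
      ∫ x : Fin m → ℝ, (fun u : Fin m → ℝ =>
        Complex.exp (((2 * Real.pi : ℝ) : ℂ) * Complex.I * ∑ i, (u i : ℂ) * (y i : ℂ)) *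
          𝓕 (toEuclid φ) (WithLp.toLp 2 u)) ((ε / (2 * Real.pi)) • x) := by
    rw [h1, bosFT]
    refine integral_congr_ae (.of_forall fun x => ?_)
    have hpi : (Real.pi : ℂ) ≠ 0 := by exact_mod_cast Real.pi_ne_zero
    simp only [Pi.smul_apply, smul_eq_mul]
    congr 2
    push_cast
    rw [Finset.mul_sum, Finset.mul_sum]
    refine Finset.sum_congr rfl fun i _ => ?_
    field_simp
  have h3 := bosFT_comp_toLp (2 * Real.pi) (𝓕 (toEuclid φ) : 𝓢(_, ℂ)) y
  rw [← SchwartzMap.fourierInv_coe, FourierTransform.fourierInv_fourier_eq,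
    div_self (by positivity), one_smul] at h3
  rw [h2, Measure.integral_comp_smul volume (fun u : Fin m → ℝ =>
    Complex.exp (((2 * Real.pi : ℝ) : ℂ) * Complex.I * ∑ i, (u i : ℂ) * (y i : ℂ)) *
      𝓕 (toEuclid φ) (WithLp.toLp 2 u))]
  unfold bosFT at h3
  rw [h3]
  have h4 : |((ε / (2 * Real.pi)) ^ Module.finrank ℝ (Fin m → ℝ))⁻¹| = (2 * Real.pi) ^ m := by
    rw [abs_inv, abs_pow, abs_div, hε, abs_of_pos (by positivity), Module.finrank_fin_fun, one_div,
      inv_pow, inv_inv]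
  rw [h4, Complex.real_smul]
  push_cast
  rfl

theorem msign_mul_self {N : ℕ} (A B : Finset (Fin N)) :
    (Gr.msign A B : ℂ) * Gr.msign A B = 1 := by
  unfold Gr.msign
  rw [← mul_pow]; simp

/-- The involution exchanging the two generators of each pair. -/
def partner (n : ℕ) (t : Fin (2 * n)) : Fin (2 * n) :=
  if h : (t : ℕ) % 2 = 0 then ⟨t + 1, by omega⟩ else ⟨t - 1, by omega⟩

theorem partner_val (n : ℕ) (t : Fin (2 * n)) :
    (partner n t : ℕ) = if (t : ℕ) % 2 = 0 then (t : ℕ) + 1 else (t : ℕ) - 1 := by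
  unfold partner; split_ifs <;> rfl

@[simp] theorem partner_partner (n : ℕ) (t : Fin (2 * n)) : partner n (partner n t) = t := by
  apply Fin.ext
  simp only [partner_val]
  split_ifs <;> omega

theorem partner_ne (n : ℕ) (t : Fin (2 * n)) : partner n t ≠ t := by
  intro h
  have := congrArg Fin.val h
  rw [partner_val] at this
  split_ifs at this <;> omega

theorem partner_injective (n : ℕ) : Function.Injective (partner n) :=
  Function.Involutive.injective (partner_partner n)

theorem partner_lt_partner {n : ℕ} {s t : Fin (2 * n)} (h : s ≠ partner n t) :
    partner n s < partner n t ↔ s < t := by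
  have h' : (s : ℕ) ≠ partner n t := fun e => h (Fin.ext e)
  rw [partner_val] at h'
  rw [Fin.lt_def, Fin.lt_def, partner_val, partner_val]
  split_ifs at h' ⊢ <;> omega

theorem mem_image_partner {n : ℕ} {s : Finset (Fin (2 * n))} {t : Fin (2 * n)} :
    t ∈ s.image (partner n) ↔ partner n t ∈ s := by
  constructor
  · rintro h
    obtain ⟨u, hu, rfl⟩ := Finset.mem_image.1 h
    simpa
  · intro h
    exact Finset.mem_image.2 ⟨_, h, partner_partner n t⟩

theorem image_partner_image_partner {n : ℕ} (s : Finset (Fin (2 * n))) :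
    (s.image (partner n)).image (partner n) = s := by
  ext; simp

/-- The subset of the generators of `Λ_{4n}` given by `U` among the `x` generators and
`s` among the `y` generators. -/
def join (n : ℕ) (U s : Finset (Fin (2 * n))) : Finset (Fin (2 * n + 2 * n)) :=
  U.image (xi n) ∪ s.image (yi n)

theorem xi_injective (n : ℕ) : Function.Injective (xi n) := Fin.castAdd_injective _ _

theorem yi_injective (n : ℕ) : Function.Injective (yi n) := Fin.natAdd_injective _ _

theorem xi_lt_yi {n : ℕ} (s t : Fin (2 * n)) : xi n s < yi n t := by
  simp only [xi, yi, Fin.lt_def, Fin.val_castAdd, Fin.val_natAdd]; omega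

theorem xi_lt_xi {n : ℕ} {s t : Fin (2 * n)} : xi n s < xi n t ↔ s < t := Iff.rfl

theorem yi_lt_yi {n : ℕ} {s t : Fin (2 * n)} : yi n s < yi n t ↔ s < t := by
  simp [yi]

theorem xi_mem_join {n : ℕ} {U s : Finset (Fin (2 * n))} {t : Fin (2 * n)} :
    xi n t ∈ join n U s ↔ t ∈ U := by
  simp only [join, mem_union, mem_image]
  constructor
  · rintro (⟨u, hu, h⟩ | ⟨u, hu, h⟩)
    · rwa [← xi_injective n h]
    · exact absurd h (xi_lt_yi t u).ne'
  · exact fun h => .inl ⟨t, h, rfl⟩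

theorem yi_mem_join {n : ℕ} {U s : Finset (Fin (2 * n))} {t : Fin (2 * n)} :
    yi n t ∈ join n U s ↔ t ∈ s := by
  simp only [join, mem_union, mem_image]
  constructor
  · rintro (⟨u, hu, h⟩ | ⟨u, hu, h⟩)
    · exact absurd h (xi_lt_yi u t).ne
    · rwa [← yi_injective n h]
  · exact fun h => .inr ⟨t, h, rfl⟩

theorem xi_or_yi {n : ℕ} (a : Fin (2 * n + 2 * n)) :
    (∃ t, a = xi n t) ∨ ∃ t, a = yi n t := by
  refine Fin.addCases (fun t => .inl ⟨t, rfl⟩) (fun t => .inr ⟨t, rfl⟩) a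

theorem ext_join {n : ℕ} {A B : Finset (Fin (2 * n + 2 * n))}
    (hx : ∀ t, xi n t ∈ A ↔ xi n t ∈ B) (hy : ∀ t, yi n t ∈ A ↔ yi n t ∈ B) : A = B := by
  ext a
  rcases xi_or_yi a with ⟨t, rfl⟩ | ⟨t, rfl⟩
  · exact hx t
  · exact hy t

theorem subset_of_join {n : ℕ} {A B : Finset (Fin (2 * n + 2 * n))}
    (hx : ∀ t, xi n t ∈ A → xi n t ∈ B) (hy : ∀ t, yi n t ∈ A → yi n t ∈ B) : A ⊆ B := by
  intro a
  rcases xi_or_yi a with ⟨t, rfl⟩ | ⟨t, rfl⟩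
  · exact hx t
  · exact hy t

theorem join_inj {n : ℕ} {U s V t : Finset (Fin (2 * n))} :
    join n U s = join n V t ↔ U = V ∧ s = t := by
  constructor
  · intro h
    constructor
    · ext a; rw [← xi_mem_join (s := s), h, xi_mem_join]
    · ext a; rw [← yi_mem_join (U := U), h, yi_mem_join]
  · rintro ⟨rfl, rfl⟩; rfl

theorem join_sdiff_join {n : ℕ} (U s V t : Finset (Fin (2 * n))) :
    join n U s \ join n V t = join n (U \ V) (s \ t) := by
  apply ext_join <;> intro a <;> simp [xi_mem_join, yi_mem_join]

theorem join_subset_join {n : ℕ} {U s V t : Finset (Fin (2 * n))} :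
    join n U s ⊆ join n V t ↔ U ⊆ V ∧ s ⊆ t := by
  constructor
  · intro h
    exact ⟨fun a ha => xi_mem_join.1 (h (xi_mem_join.2 ha)),
      fun a ha => yi_mem_join.1 (h (yi_mem_join.2 ha))⟩
  · rintro ⟨h1, h2⟩
    apply subset_of_join <;> intro a <;> simp only [xi_mem_join, yi_mem_join]
    · exact fun h => h1 h
    · exact fun h => h2 h

theorem msign_eq_prod {N : ℕ} (A B : Finset (Fin N)) :
    (Gr.msign A B : ℂ) = ∏ a ∈ A, ∏ b ∈ B, if b < a then -1 else 1 := by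
  rw [Gr.msign, ← Finset.prod_product', Finset.prod_ite]
  simp

theorem prod_join {n : ℕ} (U s : Finset (Fin (2 * n))) (f : Fin (2 * n + 2 * n) → ℂ) :
    ∏ a ∈ join n U s, f a = (∏ a ∈ U, f (xi n a)) * ∏ a ∈ s, f (yi n a) := by
  unfold join
  rw [Finset.prod_union, Finset.prod_image (fun _ _ _ _ h => xi_injective n h),
    Finset.prod_image (fun _ _ _ _ h => yi_injective n h)]
  rw [Finset.disjoint_left]
  intro a ha hb
  obtain ⟨u, _, rfl⟩ := Finset.mem_image.1 ha
  obtain ⟨v, _, h⟩ := Finset.mem_image.1 hb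
  exact (xi_lt_yi u v).ne' h

theorem msign_join {n : ℕ} (U s V t : Finset (Fin (2 * n))) :
    (Gr.msign (join n U s) (join n V t) : ℂ) =
      Gr.msign U V * Gr.msign s t * (-1) ^ (s.card * V.card) := by
  simp only [msign_eq_prod, prod_join, xi_lt_xi, yi_lt_yi, xi_lt_yi, (xi_lt_yi _ _).not_gt,
    if_true, if_false, prod_mul_distrib, prod_const, one_pow]
  rw [← pow_mul]
  ring

theorem mul_single {N : ℕ} (f : Gr ℂ N) (P S : Finset (Fin N)) (d : ℂ) :
    Gr.mul f (fun A => if A = P then d else 0) S =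
      if P ⊆ S then Gr.msign (S \ P) P * f (S \ P) * d else 0 := by
  unfold Gr.mul
  split_ifs with h
  · rw [Finset.sum_eq_single (S \ P)]
    · simp [h]
    · intro A hA hne
      refine mul_eq_zero_of_right _ (if_neg ?_)
      rintro rfl
      exact hne (by simp [Finset.mem_powerset.1 hA])
    · simp
  · refine Finset.sum_eq_zero fun A hA => ?_
    refine mul_eq_zero_of_right _ (if_neg ?_)
    rintro rfl
    exact h Finset.sdiff_subset

theorem mul_sum {N : ℕ} {ι : Type} (T : Finset ι) (f : Gr ℂ N) (g : ι → Gr ℂ N) :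
    Gr.mul f (∑ t ∈ T, g t) = ∑ t ∈ T, Gr.mul f (g t) := by
  funext S
  simp only [Gr.mul, Finset.sum_apply, Finset.mul_sum]
  exact Finset.sum_comm

theorem gen_mul_gen {N : ℕ} {a b : Fin N} (h : a < b) :
    Gr.mul (Gr.gen a) (Gr.gen b) = fun S => if S = {a, b} then (1 : ℂ) else 0 := by
  funext S
  have hb : (Gr.gen b : Gr ℂ N) = fun A => if A = {b} then (1 : ℂ) else 0 := rfl
  rw [hb, mul_single]
  by_cases hS : S = {a, b}
  · subst hS
    have : ({a, b} : Finset (Fin N)) \ {b} = {a} := by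
      ext x; simp only [mem_sdiff, mem_insert, mem_singleton]; grind
    rw [if_pos (by simp), if_pos rfl, this]
    simp [Gr.gen, Gr.msign, Finset.filter_singleton, h.not_gt]
  · rw [if_neg hS]
    split_ifs with hs
    · have : S \ {b} ≠ {a} := by
        intro e
        apply hS
        rw [← Finset.sdiff_union_of_subset hs, e]; rfl
      simp [Gr.gen, this]
    · rfl

theorem sum_pairs {M : Type} [AddCommMonoid M] (n : ℕ) (f : Fin (2 * n) → M) :
    ∑ t, f t = ∑ j : Fin n, (f (lo n j) + f (hi n j)) := by
  induction n with
  | zero => simp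
  | succ n ih =>
    have h := Fin.sum_univ_castSucc (n := n) fun j => f (lo (n + 1) j) + f (hi (n + 1) j)
    rw [h]
    have h2 : ∑ t, f t = ∑ t : Fin (2 * n + 1 + 1), f t := rfl
    rw [h2, Fin.sum_univ_castSucc, Fin.sum_univ_castSucc, ih, add_assoc]
    rfl

/-- The sign of the term `x_t y_{t*}` in the exponent of the fermionic kernel. -/
def pairSign (n : ℕ) (t : Fin (2 * n)) : ℂ := if (t : ℕ) % 2 = 0 then 1 else -1

theorem fermK_exponent (n : ℕ) (c : ℂ) :
    (c • ∑ j : Fin n,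
      (Gr.mul (Gr.gen (xi n (lo n j))) (Gr.gen (yi n (hi n j))) -
       Gr.mul (Gr.gen (xi n (hi n j))) (Gr.gen (yi n (lo n j)))) : Gr ℂ (2 * n + 2 * n)) =
    ∑ t : Fin (2 * n), fun S =>
      if S = join n {t} {partner n t} then c * pairSign n t else 0 := by
  rw [sum_pairs, Finset.smul_sum]
  refine Finset.sum_congr rfl fun j _ => ?_
  have h1 : partner n (lo n j) = hi n j := Fin.ext (by simp [partner_val, lo, hi])
  have h2 : partner n (hi n j) = lo n j := by rw [← h1, partner_partner]
  have h3 : ∀ a b, join n {a} {b} = {xi n a, yi n b} := fun a b => by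
    simp [join]
  have h4 : pairSign n (lo n j) = 1 := by simp [pairSign, lo]
  have h5 : pairSign n (hi n j) = -1 := by simp [pairSign, hi, Nat.add_mod]
  funext S
  rw [gen_mul_gen (xi_lt_yi _ _), gen_mul_gen (xi_lt_yi _ _)]
  simp only [Pi.smul_apply, Pi.sub_apply, Pi.add_apply, smul_eq_mul, h1, h2, h3, h4, h5]
  split_ifs <;> ring

/-- The sign of the pairs of which `U` contains only the second generator. -/
def halfSign (n : ℕ) (U : Finset (Fin (2 * n))) : ℂ :=
  ∏ u, if u ∈ U ∧ (u : ℕ) % 2 = 1 ∧ partner n u ∉ U then -1 else 1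

theorem halfSign_mul_self (n : ℕ) (U : Finset (Fin (2 * n))) :
    halfSign n U * halfSign n U = 1 := by
  unfold halfSign
  rw [← prod_mul_distrib]
  exact Finset.prod_eq_one fun u _ => by split_ifs <;> norm_num

theorem partner_mod_two (n : ℕ) (t : Fin (2 * n)) :
    (partner n t : ℕ) % 2 = 1 ↔ (t : ℕ) % 2 = 0 := by
  rw [partner_val]; split_ifs <;> omega

theorem halfSign_insert {n : ℕ} {t : Fin (2 * n)} {V : Finset (Fin (2 * n))} (ht : t ∉ V) :
    halfSign n (insert t V) =
      halfSign n V * ((if partner n t ∈ V then -1 else 1) * pairSign n t) := by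
  have key : halfSign n (insert t V) = ∏ u,
      ((if u ∈ V ∧ (u : ℕ) % 2 = 1 ∧ partner n u ∉ V then (-1 : ℂ) else 1) *
        ((if u = t then (if (t : ℕ) % 2 = 1 ∧ partner n t ∉ V then -1 else 1) else 1) *
        (if u = partner n t then
          (if partner n t ∈ V ∧ (t : ℕ) % 2 = 0 then -1 else 1) else 1))) := by
    refine Finset.prod_congr rfl fun u _ => ?_
    by_cases h1 : u = t
    · subst h1
      simp [ht, (partner_ne n u).symm, partner_ne n u]
    · by_cases h2 : u = partner n t
      · subst h2
        simp only [mem_insert, partner_partner, true_or, not_true_eq_false, and_false, if_false,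
          partner_mod_two, ht, not_false_eq_true, and_true, partner_ne n t, if_true, one_mul]
        split_ifs <;> norm_num
      · have h3 : partner n u ≠ t := fun h => h2 (by rw [← h, partner_partner])
        simp [h1, h2, h3]
  rw [key, prod_mul_distrib, prod_mul_distrib, Finset.prod_ite_eq', Finset.prod_ite_eq', halfSign]
  simp only [mem_univ, if_true, pairSign]
  congr 1
  rcases Nat.mod_two_eq_zero_or_one (t : ℕ) with h | h <;>
    by_cases h' : partner n t ∈ V <;> simp [h, h']

/-- The coefficient of the fermionic kernel `exp(c Σ ± x_t y_{t*})` at the monomial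
`x_U y_{U*}`. -/
def kerCoeff (n : ℕ) (c : ℂ) (U : Finset (Fin (2 * n))) : ℂ :=
  c ^ U.card * (-1) ^ (U.card.choose 2) * halfSign n U

theorem msign_singleton_mul_msign_partner {n : ℕ} {t : Fin (2 * n)} {V : Finset (Fin (2 * n))} :
    (Gr.msign V {t} * Gr.msign (V.image (partner n)) {partner n t} : ℂ) =
      if partner n t ∈ V then -1 else 1 := by
  rw [msign_eq_prod, msign_eq_prod, Finset.prod_image fun _ _ _ _ h => partner_injective n h,
    ← prod_mul_distrib, ← Finset.prod_ite_eq' V (partner n t) fun _ => (-1 : ℂ)]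
  refine Finset.prod_congr rfl fun u hu => ?_
  simp only [prod_singleton]
  by_cases h : u = partner n t
  · subst h
    have hne := partner_ne n t
    rw [partner_partner, if_pos rfl]
    rcases lt_or_gt_of_ne hne with h | h <;> simp [h, h.not_gt]
  · have h3 : t ≠ partner n u := fun e => h (by rw [e, partner_partner])
    simp only [partner_lt_partner h3, if_neg h]
    split_ifs <;> norm_num

theorem kerCoeff_insert {n : ℕ} {t : Fin (2 * n)} {V : Finset (Fin (2 * n))} (c : ℂ)
    (ht : t ∉ V) :
    Gr.msign (join n V (V.image (partner n))) (join n {t} {partner n t}) * kerCoeff n c V *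
      (c * pairSign n t) = kerCoeff n c (insert t V) := by
  rw [msign_join, msign_singleton_mul_msign_partner, kerCoeff, kerCoeff, halfSign_insert ht,
    Finset.card_insert_of_notMem ht, Finset.card_image_of_injective _ (partner_injective n),
    Finset.card_singleton, Nat.choose_succ_succ' V.card 1, Nat.choose_one_right, pow_add, pow_succ]
  ring

theorem image_partner_sdiff {n : ℕ} (U : Finset (Fin (2 * n))) (t : Fin (2 * n)) :
    U.image (partner n) \ {partner n t} = (U \ {t}).image (partner n) := by
  rw [Finset.image_sdiff _ _ (partner_injective n), Finset.image_singleton]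

theorem pow_exponent (n : ℕ) (c : ℂ) (k : ℕ) : ∀ U s : Finset (Fin (2 * n)),
    Gr.pow (∑ t : Fin (2 * n), fun S =>
      if S = join n {t} {partner n t} then c * pairSign n t else 0) k (join n U s) =
      if s = U.image (partner n) ∧ U.card = k then (k.factorial : ℂ) * kerCoeff n c U else 0 := by
  induction k with
  | zero =>
    intro U s
    have h : join n U s = ∅ ↔ s = U.image (partner n) ∧ U.card = 0 := by
      rw [Finset.card_eq_zero]
      constructor
      · intro h
        have : join n U s = join n ∅ ∅ := by rw [h]; simp [join]
        obtain ⟨rfl, rfl⟩ := join_inj.1 this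
        simp
      · rintro ⟨rfl, rfl⟩
        simp [join]
    simp only [Gr.pow, Gr.one, h]
    split_ifs with h'
    · rw [Finset.card_eq_zero] at h'
      simp [h'.2, kerCoeff, halfSign]
    · rfl
  | succ k ih =>
    intro U s
    simp only [Gr.pow]
    rw [mul_sum, Finset.sum_apply]
    simp only [mul_single, join_subset_join, join_sdiff_join, ih, Finset.singleton_subset_iff]
    split_ifs with h
    · obtain ⟨rfl, hk⟩ := h
      have : ∀ t : Fin (2 * n), (if t ∈ U ∧ partner n t ∈ U.image (partner n) then
          Gr.msign (join n (U \ {t}) (U.image (partner n) \ {partner n t}))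
              (join n {t} {partner n t}) *
            (if U.image (partner n) \ {partner n t} = (U \ {t}).image (partner n) ∧
              (U \ {t}).card = k then (k.factorial : ℂ) * kerCoeff n c (U \ {t}) else 0) *
            (c * pairSign n t) else 0) =
          if t ∈ U then (k.factorial : ℂ) * kerCoeff n c U else 0 := by
        intro t
        by_cases ht : t ∈ U
        · have hc : (U \ {t}).card = k := by
            rw [Finset.card_sdiff_of_subset (by simpa using ht), Finset.card_singleton, hk]; simp
          have hi : insert t (U \ {t}) = U := by
            rw [Finset.sdiff_singleton_eq_erase, Finset.insert_erase ht]
          rw [if_pos ⟨ht, Finset.mem_image_of_mem _ ht⟩, if_pos ht, image_partner_sdiff,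
            if_pos ⟨rfl, hc⟩]
          have := kerCoeff_insert (V := U \ {t}) (t := t) c (by simp)
          rw [hi] at this
          rw [← this]
          ring
        · rw [if_neg (fun h => ht h.1), if_neg ht]
      rw [Finset.sum_congr rfl fun t _ => this t]
      simp only [Finset.sum_ite_mem, Finset.univ_inter, Finset.sum_const, hk, nsmul_eq_mul,
        Nat.factorial_succ]
      push_cast
      ring
    · refine Finset.sum_eq_zero fun t _ => ?_
      split_ifs with h1 h2
      · exfalso
        apply h
        obtain ⟨h2, h3⟩ := h2
        constructor
        · rw [← image_partner_sdiff] at h2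
          rw [← Finset.sdiff_union_of_subset (Finset.singleton_subset_iff.2 h1.2), h2,
            Finset.sdiff_union_of_subset
              (Finset.singleton_subset_iff.2 (Finset.mem_image_of_mem _ h1.1))]
        · rw [← h3, Finset.card_sdiff_of_subset (by simpa using h1.1), Finset.card_singleton]
          have := Finset.card_pos.2 ⟨t, h1.1⟩
          omega
      · simp
      · rfl

theorem fermK_join (n : ℕ) (σ : ℂ) (U s : Finset (Fin (2 * n))) :
    fermK n σ (join n U s) =
      if s = U.image (partner n) then kerCoeff n (-σ * (Complex.I / 2)) U else 0 := by
  rw [fermK, fermK_exponent, Gr.gexp, Finset.sum_apply]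
  simp only [Pi.smul_apply, pow_exponent, smul_eq_mul]
  split_ifs with h
  · rw [Finset.sum_eq_single U.card]
    · rw [if_pos ⟨h, rfl⟩, ← mul_assoc, inv_mul_cancel₀, one_mul]
      exact_mod_cast Nat.factorial_ne_zero _
    · intro k _ hk
      rw [if_neg (fun h' => hk h'.2.symm), mul_zero]
    · intro h'
      have := Finset.card_le_univ U
      rw [Fintype.card_fin] at this
      simp at h'
      omega
  · exact Finset.sum_eq_zero fun k _ => by rw [if_neg (fun h' => h h'.1), mul_zero]

theorem derivList_apply {N : ℕ} (l : List (Fin N)) (F : Gr ℂ N) (S : Finset (Fin N))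
    (hl : l.Pairwise (· < ·)) (h : ∀ a ∈ l, ∀ b ∈ S, a < b) :
    Gr.derivList l F S = F (l.toFinset ∪ S) := by
  induction l generalizing F with
  | nil => simp [Gr.derivList]
  | cons a l ih =>
    rw [List.pairwise_cons] at hl
    have h' : ∀ b ∈ l.toFinset ∪ S, a < b := by
      intro b hb
      rcases Finset.mem_union.1 hb with hb | hb
      · exact hl.1 b (List.mem_toFinset.1 hb)
      · exact h a (by simp) b hb
    have h0 : Gr.derivList (a :: l) F S = Gr.derivList l (Gr.pderiv a F) S := rfl
    rw [h0, ih _ hl.2 fun b hb => h b (by simp [hb]), Gr.pderiv,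
      if_neg fun ha => lt_irrefl _ (h' a ha),
      Finset.filter_false_of_mem fun b hb => (h' b hb).not_gt, List.toFinset_cons,
      Finset.insert_union]
    simp

theorem berezinX_apply (n : ℕ) (F : Gr ℂ (2 * n + 2 * n)) (s : Finset (Fin (2 * n))) :
    berezinX n F (s.image (yi n)) = ((Real.pi : ℂ) ^ n)⁻¹ * F (join n univ s) := by
  rw [berezinX, Pi.smul_apply, smul_eq_mul, derivList_apply]
  · congr 2
  · rw [List.pairwise_map]
    exact (List.pairwise_lt_finRange _).imp fun h => xi_lt_xi.2 h
  · intro a ha b hb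
    obtain ⟨t, _, rfl⟩ := List.mem_map.1 ha
    obtain ⟨u, _, rfl⟩ := Finset.mem_image.1 hb
    exact xi_lt_yi t u

/-- The fermionic Fourier transform maps the monomial indexed by `dual n s` to a multiple of
the one indexed by `s`. -/
def dual (n : ℕ) (s : Finset (Fin (2 * n))) : Finset (Fin (2 * n)) := (s.image (partner n))ᶜ

/-- The coefficient with which the fermionic Fourier transform maps the monomial indexed by
`dual n s` to the one indexed by `s`, up to normalisation. -/
def dualCoeff (n : ℕ) (c : ℂ) (s : Finset (Fin (2 * n))) : ℂ :=
  Gr.msign (dual n s)ᶜ (dual n s) * (-1) ^ (s.card * (dual n s).card) * kerCoeff n c (dual n s)ᶜ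

theorem dual_dual (n : ℕ) (s : Finset (Fin (2 * n))) : dual n (dual n s) = s := by
  ext t
  rw [dual, mem_compl, mem_image_partner, dual, mem_compl, mem_image_partner, partner_partner,
    not_not]

theorem compl_dual (n : ℕ) (s : Finset (Fin (2 * n))) : (dual n s)ᶜ = s.image (partner n) :=
  compl_compl _

theorem embX_eq_sum (n : ℕ) (g : Gr ℂ (2 * n)) :
    embX n g = ∑ A : Finset (Fin (2 * n)), fun s => if s = join n A ∅ then g A else 0 := by
  funext s
  simp [embX, join, Finset.sum_apply]

theorem berezinX_kernel (n : ℕ) (σ : ℂ) (g : Gr ℂ (2 * n)) (s : Finset (Fin (2 * n))) :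
    berezinX n (Gr.mul (fermK n σ) (embX n g)) (s.image (yi n)) =
      ((Real.pi : ℂ) ^ n)⁻¹ * dualCoeff n (-σ * (Complex.I / 2)) s * g (dual n s) := by
  rw [berezinX_apply, mul_assoc, embX_eq_sum, mul_sum, Finset.sum_apply]
  congr 1
  rw [Finset.sum_eq_single (dual n s)]
  · rw [mul_single, if_pos (join_subset_join.2 ⟨Finset.subset_univ _, Finset.empty_subset _⟩),
      join_sdiff_join, msign_join, Finset.sdiff_empty, fermK_join, ← Finset.compl_eq_univ_sdiff,
      if_pos (by rw [compl_dual, image_partner_image_partner]), dualCoeff]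
    simp [Gr.msign]
  · intro A _ hA
    rw [mul_single]
    split_ifs
    · rw [join_sdiff_join, Finset.sdiff_empty, fermK_join, if_neg, mul_zero, zero_mul]
      rintro rfl
      apply hA
      rw [dual, image_partner_image_partner, ← Finset.compl_eq_univ_sdiff, compl_compl]
    · rfl
  · simp

theorem choose_two_add (k l : ℕ) : (k + l).choose 2 = k.choose 2 + l.choose 2 + k * l := by
  induction l with
  | zero => simp
  | succ l ih =>
    rw [← add_assoc, Nat.choose_succ_succ' (k + l) 1, ih, Nat.choose_succ_succ' l 1]
    simp only [Nat.choose_one_right]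
    ring

theorem neg_one_pow_choose_two {k l n : ℕ} (h : k + l = 2 * n) :
    (-1 : ℂ) ^ (k.choose 2 + l.choose 2 + l) = (-1) ^ n := by
  have h1 := choose_two_add k l
  rw [h, Nat.choose_two_right, mul_assoc, Nat.mul_div_cancel_left _ two_pos] at h1
  rw [neg_one_pow_eq_pow_mod_two, neg_one_pow_eq_pow_mod_two n]
  congr 1
  have hkl : k % 2 = l % 2 := by omega
  have e1 : (n * (2 * n - 1)) % 2 = n % 2 := by
    rcases n with _ | n
    · rfl
    · rw [Nat.mul_mod, show (2 * (n + 1) - 1) % 2 = 1 by omega]; simp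
  have e2 : (k * l) % 2 = l % 2 := by
    rw [Nat.mul_mod, hkl]
    rcases Nat.mod_two_eq_zero_or_one l with h | h <;> simp [h]
  omega

theorem kerCoeff_mul_kerCoeff_neg (n : ℕ) (c : ℂ) (s : Finset (Fin (2 * n))) :
    kerCoeff n c (s.image (partner n)) * kerCoeff n (-c) sᶜ = (-c ^ 2) ^ n := by
  have hs : halfSign n (s.image (partner n)) = halfSign n sᶜ := by
    refine Finset.prod_congr rfl fun u _ => ?_
    simp only [mem_image_partner, partner_partner, mem_compl, not_not]
    congr 1
    exact propext (by tauto)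
  have hcard : s.card + sᶜ.card = 2 * n := by rw [Finset.card_add_card_compl, Fintype.card_fin]
  rw [kerCoeff, kerCoeff, hs, Finset.card_image_of_injective _ (partner_injective n), neg_pow c]
  calc _ = c ^ (s.card + sᶜ.card) *
        (-1) ^ (s.card.choose 2 + sᶜ.card.choose 2 + sᶜ.card) *
        (halfSign n sᶜ * halfSign n sᶜ) := by ring
    _ = _ := by
      rw [halfSign_mul_self, neg_one_pow_choose_two hcard, hcard, pow_mul, mul_one, ← mul_pow]
      ring

theorem prod_partner_mem (n : ℕ) (s : Finset (Fin (2 * n))) :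
    ∏ p ∈ s, (if partner n p ∈ s then (-1 : ℂ) else 1) = 1 := by
  rw [← Finset.prod_filter]
  refine Finset.prod_involution (fun p _ => partner n p) (by simp)
    (fun p _ _ => partner_ne n p) ?_ (by simp)
  intro p hp
  rw [Finset.mem_filter] at hp ⊢
  simpa using hp.symm

theorem msign_image_partner_mul (n : ℕ) (s : Finset (Fin (2 * n))) :
    (Gr.msign (s.image (partner n)) (s.image (partner n))ᶜ * Gr.msign sᶜ s : ℂ) = 1 := by
  have hc : (s.image (partner n))ᶜ = sᶜ.image (partner n) := by
    ext t; rw [mem_compl, mem_image_partner, mem_image_partner, mem_compl]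
  have hcard : s.card + sᶜ.card = 2 * n := by rw [Finset.card_add_card_compl, Fintype.card_fin]
  have hsign : (-1 : ℂ) ^ sᶜ.card = (-1) ^ s.card := by
    rw [neg_one_pow_eq_pow_mod_two, neg_one_pow_eq_pow_mod_two s.card]
    congr 1
    omega
  rw [hc, msign_eq_prod, msign_eq_prod, Finset.prod_comm (s := sᶜ),
    Finset.prod_image fun _ _ _ _ h => partner_injective n h, ← prod_mul_distrib]
  have h1 : ∀ p ∈ s, (∏ b ∈ sᶜ.image (partner n), if b < partner n p then (-1 : ℂ) else 1) *
      (∏ q ∈ sᶜ, if p < q then -1 else 1) =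
      (-1) ^ s.card * (-1) * if partner n p ∈ s then -1 else 1 := by
    intro p hp
    rw [Finset.prod_image fun _ _ _ _ h => partner_injective n h, ← prod_mul_distrib]
    have h2 : ∀ q ∈ sᶜ, (if partner n q < partner n p then (-1 : ℂ) else 1) *
        (if p < q then -1 else 1) = -1 * if q = partner n p then -1 else 1 := by
      intro q hq
      have hqp : q ≠ p := fun h => (Finset.mem_compl.1 hq) (h ▸ hp)
      by_cases h : q = partner n p
      · subst h
        rw [partner_partner, if_pos rfl]
        split_ifs <;> norm_num
      · simp only [partner_lt_partner h]
        rcases lt_or_gt_of_ne hqp with h' | h' <;> simp [h, h', h'.not_gt]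
    rw [Finset.prod_congr rfl h2, prod_mul_distrib, Finset.prod_ite_eq', prod_const, hsign]
    by_cases h : partner n p ∈ s <;> simp [h]
  rw [Finset.prod_congr rfl h1, prod_mul_distrib, prod_partner_mem, prod_const, mul_one,
    ← pow_succ, ← pow_mul, mul_comm]
  exact (Nat.even_mul_succ_self _).neg_one_pow

theorem dualCoeff_mul_dualCoeff_neg (n : ℕ) (c : ℂ) (s : Finset (Fin (2 * n))) :
    dualCoeff n c s * dualCoeff n (-c) (dual n s) = (-c ^ 2) ^ n := by
  rw [dualCoeff, dualCoeff, dual_dual, compl_dual, mul_comm (dual n s).card]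
  calc _ = (Gr.msign (s.image (partner n)) (s.image (partner n))ᶜ * Gr.msign sᶜ s) *
        (kerCoeff n c (s.image (partner n)) * kerCoeff n (-c) sᶜ) *
        ((-1) ^ (s.card * (dual n s).card) * (-1) ^ (s.card * (dual n s).card)) := by
        rw [← dual]; ring
    _ = _ := by
      rw [msign_image_partner_mul, kerCoeff_mul_kerCoeff_neg, ← mul_pow]
      simp

theorem superFT_apply (m n : ℕ) (σ : ℂ) (f : SF m n) (y : Fin m → ℝ)
    (s : Finset (Fin (2 * n))) :
    superFT m n σ f y s =
      (((2 * Real.pi : ℝ) : ℂ) ^ ((-((m : ℂ) - 2 * (n : ℂ))) / 2) * ((Real.pi : ℂ) ^ n)⁻¹ *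
        dualCoeff n (-σ * (Complex.I / 2)) s) * bosFT σ (fun x => f x (dual n s)) y := by
  rw [mul_assoc, mul_assoc, ← mul_assoc ((Real.pi : ℂ) ^ n)⁻¹, ← bosFT_const_mul]
  simp only [superFT, berezinX_kernel, bosFT]

theorem isSchwartz_superFT {m n : ℕ} {ε : ℝ} (hε : ε ≠ 0) {f : SF m n} (hf : IsSchwartz m n f) :
    IsSchwartz m n (superFT m n ε f) := by
  intro s
  obtain ⟨φ, hφ⟩ := hf (dual n s)
  obtain ⟨ψ, hψ⟩ := exists_schwartz_bosFT hε φ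
  refine ⟨(((2 * Real.pi : ℝ) : ℂ) ^ ((-((m : ℂ) - 2 * (n : ℂ))) / 2) * ((Real.pi : ℂ) ^ n)⁻¹ *
    dualCoeff n (-ε * (Complex.I / 2)) s) • ψ, fun y => ?_⟩
  rw [superFT_apply, funext hφ, hψ]
  rfl

theorem superFT_normalisation (m n : ℕ) :
    (((2 * Real.pi : ℝ) : ℂ) ^ ((-((m : ℂ) - 2 * (n : ℂ))) / 2) * ((Real.pi : ℂ) ^ n)⁻¹) ^ 2 *
      (1 / 4) ^ n * ((2 * Real.pi : ℝ) : ℂ) ^ m = 1 := by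
  have hpi : (Real.pi : ℂ) ≠ 0 := by exact_mod_cast Real.pi_ne_zero
  have h2 : ((2 * Real.pi : ℝ) : ℂ) ≠ 0 := by exact_mod_cast (by positivity : (2 * Real.pi) ≠ 0)
  have h1 : (((2 * Real.pi : ℝ) : ℂ) ^ ((-((m : ℂ) - 2 * (n : ℂ))) / 2)) ^ 2 *
      ((2 * Real.pi : ℝ) : ℂ) ^ m = (((2 * Real.pi : ℝ) : ℂ) ^ 2) ^ n := by
    rw [← Complex.cpow_nat_mul, ← Complex.cpow_natCast _ m, ← Complex.cpow_add _ _ h2, ← pow_mul,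
      ← Complex.cpow_natCast]
    congr 1
    push_cast
    ring
  calc _ = ((((2 * Real.pi : ℝ) : ℂ) ^ ((-((m : ℂ) - 2 * (n : ℂ))) / 2)) ^ 2 *
      ((2 * Real.pi : ℝ) : ℂ) ^ m) * ((Real.pi : ℂ) ^ n)⁻¹ ^ 2 * (1 / 4) ^ n := by ring
    _ = _ := by
      rw [h1, ← inv_pow, pow_right_comm _ n 2, ← mul_pow, ← mul_pow]
      push_cast
      convert one_pow n using 2
      field_simp
      norm_num

theorem superFT_superFT_neg {m n : ℕ} {ε : ℝ} (hε : |ε| = 1) {f : SF m n}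
    (hf : IsSchwartz m n f) : superFT m n ε (superFT m n (-ε) f) = f := by
  funext y s
  obtain ⟨φ, hφ⟩ := hf s
  have hinner : (fun x => superFT m n (-ε) f x (dual n s)) = fun x =>
      (((2 * Real.pi : ℝ) : ℂ) ^ ((-((m : ℂ) - 2 * (n : ℂ))) / 2) * ((Real.pi : ℂ) ^ n)⁻¹ *
        dualCoeff n (-(-ε * (Complex.I / 2))) (dual n s)) * bosFT (-ε) φ x := by
    funext x
    rw [superFT_apply, dual_dual, funext hφ, neg_mul (-(ε : ℂ))]
  have hε2 : (ε : ℂ) ^ 2 = 1 := by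
    rw [← Complex.ofReal_pow, ← sq_abs, hε]; simp
  have hd := dualCoeff_mul_dualCoeff_neg n (-ε * (Complex.I / 2)) s
  have hc : -(-(ε : ℂ) * (Complex.I / 2)) ^ 2 = 1 / 4 := by
    rw [mul_pow, neg_sq, hε2, div_pow, Complex.I_sq]; norm_num
  rw [hc] at hd
  rw [superFT_apply, hinner, bosFT_const_mul, bosFT_bosFT_neg hε, hφ]
  have hN := superFT_normalisation m n
  rw [← hd] at hN
  linear_combination φ y * hN

end SuperFourier

/-- Inversion theorem for the super Fourier transform: `F^+_{m|2n} ∘ F^-_{m|2n} = id`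
and `F^-_{m|2n} ∘ F^+_{m|2n} = id` on `S(ℝ^m)_{m|2n}`; consequently `F^±_{m|2n}`
(sign `σ = ±1`) is a (clearly linear) isomorphism of `S(ℝ^m)_{m|2n}`. -/
theorem superFT_inversion (m n : ℕ) (hm : 1 ≤ m) (σ : ℂ) (hσ : σ = 1 ∨ σ = -1) :
    (∀ f : SF m n, IsSchwartz m n f → superFT m n σ (superFT m n (-σ) f) = f) ∧
    (∀ f : SF m n, IsSchwartz m n f → superFT m n (-σ) (superFT m n σ f) = f) ∧
    Set.BijOn (superFT m n σ) {f : SF m n | IsSchwartz m n f}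
      {f : SF m n | IsSchwartz m n f} := by
  obtain ⟨ε, hε, rfl⟩ : ∃ ε : ℝ, |ε| = 1 ∧ (ε : ℂ) = σ := by
    rcases hσ with rfl | rfl
    · exact ⟨1, by simp, by simp⟩
    · exact ⟨-1, by simp, by simp⟩
  have hε0 : ε ≠ 0 := by
    rintro rfl
    simp at hε
  have h1 : ∀ f : SF m n, IsSchwartz m n f → superFT m n ε (superFT m n (-ε) f) = f :=
    fun f hf => SuperFourier.superFT_superFT_neg hε hf
  have h2 : ∀ f : SF m n, IsSchwartz m n f → superFT m n (-ε) (superFT m n ε f) = f := by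
    intro f hf
    simpa using SuperFourier.superFT_superFT_neg (ε := -ε) (by rwa [abs_neg]) hf
  refine ⟨h1, h2, Set.BijOn.mk (fun f hf => SuperFourier.isSchwartz_superFT hε0 hf)
    (Set.LeftInvOn.injOn (f₁' := superFT m n (-ε)) fun f hf => h2 f hf) fun f hf => ?_⟩
  refine ⟨superFT m n (-ε) f, ?_, h1 f hf⟩
  simpa using SuperFourier.isSchwartz_superFT (neg_ne_zero.2 hε0) hf
end
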